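/- Let a ≥ 1 and n ≥ 3, and let V = (ℂ^{a+1})^{⊗n} carry the Segre of n copies of ℙ^a. (i) For all positive integers r and k with r+1 ≤ (a+1)^n − (3a+1)(a+1)^{n−2} and k ≤ (r+1)/(an+1), the general linear subspace of V of dimension r+1 which is tangent to the Segre at k general points is tangent only at those points. (ii) Consequently, the Segre product of n copies of ℙ^a is k-identifiable for every positive integer k ≤ ((a+1)^n − (3a+1)(a+1)^{n−2})/(an+1). -/

import Mathlib

open scoped TensorProduct
open PiTensorProduct

noncomputable section

/-- The space of tensors `V = ℂ^{a₁+1} ⊗ ⋯ ⊗ ℂ^{a_q+1}`. -/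
abbrev Ten (q : ℕ) (a : Fin q → ℕ) : Type :=
  ⨂[ℂ] i : Fin q, (Fin (a i + 1) → ℂ)

/-- Index type for the coordinates on the parameter space `W_k`. -/
abbrev WIdx (q : ℕ) (a : Fin q → ℕ) (k : ℕ) : Type :=
  Fin k × Σ j : Fin q, Fin (a j + 1)

/-- Index type for the standard (decomposable) basis of `Ten q a`. -/
abbrev BIdx (q : ℕ) (a : Fin q → ℕ) : Type := ∀ j : Fin q, Fin (a j + 1)

/-- A tensor is decomposable if it is `v₁ ⊗ ⋯ ⊗ v_q` with all `vᵢ ≠ 0`. -/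
def IsDecomposable {q : ℕ} {a : Fin q → ℕ} (t : Ten q a) : Prop :=
  ∃ v : ∀ j : Fin q, Fin (a j + 1) → ℂ, (∀ j, v j ≠ 0) ∧ t = tprod ℂ v

/-- The affine tangent space at `v₁ ⊗ ⋯ ⊗ v_q` to the cone over the Segre variety:
the span of all tensors obtained by replacing one factor of `v` by an arbitrary vector. -/
def tangent {q : ℕ} (a : Fin q → ℕ) (v : ∀ j : Fin q, Fin (a j + 1) → ℂ) :
    Submodule ℂ (Ten q a) :=
  Submodule.span ℂ
    {x | ∃ (j : Fin q) (u : Fin (a j + 1) → ℂ), x = tprod ℂ (Function.update v j u)}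

/-- The map `Φ : W_k → V` sending a `k`-tuple of factor vectors to the sum of the
corresponding decomposable tensors. -/
def Phi {q : ℕ} (a : Fin q → ℕ) {k : ℕ}
    (p : Fin k → ∀ j : Fin q, Fin (a j + 1) → ℂ) : Ten q a :=
  ∑ i, tprod ℂ (p i)

/-- Evaluation of a polynomial function on `W_k` at a parameter point. -/
def evalW {q : ℕ} {a : Fin q → ℕ} {k : ℕ}
    (F : MvPolynomial (WIdx q a k) ℂ)
    (p : Fin k → ∀ j : Fin q, Fin (a j + 1) → ℂ) : ℂ :=
  MvPolynomial.eval (fun x => p x.1 x.2.1 x.2.2) F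

/-- `k`-identifiability of the Segre product `ℙ^{a₁} × ⋯ × ℙ^{a_q}`:
there is a nonzero polynomial function `F` on `W_k` such that whenever `F(p) ≠ 0`,
the tensor `Φ(p)` has a rank-`k` decomposition, and any two rank-`k` decompositions
of `Φ(p)` agree as multisets of decomposable tensors. -/
def Identifiable (q : ℕ) (a : Fin q → ℕ) (k : ℕ) : Prop :=
  ∃ F : MvPolynomial (WIdx q a k) ℂ,
    (∃ p, evalW F p ≠ 0) ∧
    ∀ p, evalW F p ≠ 0 →
      ((∃ t : Fin k → Ten q a, (∀ i, IsDecomposable (t i)) ∧ ∑ i, t i = Phi a p) ∧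
       ∀ s t : Fin k → Ten q a,
         (∀ i, IsDecomposable (s i)) → (∀ i, IsDecomposable (t i)) →
         ∑ i, s i = Phi a p → ∑ i, t i = Phi a p →
         Finset.univ.val.map s = Finset.univ.val.map t)

/-- The standard decomposable basis vector of `Ten q a` indexed by `f`. -/
def basisVec {q : ℕ} (a : Fin q → ℕ) (f : BIdx q a) : Ten q a :=
  tprod ℂ fun j => Pi.single (f j) 1

/-- The vector of `Ten q a` with coordinates `c` in the standard basis. -/
def fromCoords {q : ℕ} (a : Fin q → ℕ) (c : BIdx q a → ℂ) : Ten q a :=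
  ∑ f : BIdx q a, c f • basisVec a f

/-- Evaluation of a polynomial function on `W_k × V^e` at a parameter point. -/
def evalWV {q : ℕ} {a : Fin q → ℕ} {k e : ℕ}
    (F : MvPolynomial (WIdx q a k ⊕ (Fin e × BIdx q a)) ℂ)
    (p : Fin k → ∀ j : Fin q, Fin (a j + 1) → ℂ)
    (c : Fin e → BIdx q a → ℂ) : ℂ :=
  MvPolynomial.eval (Sum.elim (fun x => p x.1 x.2.1 x.2.2) (fun y => c y.1 y.2)) F

/-- `TangentGeneral q a k d` says: the general linear subspace of `V` of dimension `d`
which is tangent to the Segre at `k` general points is tangent only at those points.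
Concretely, with `e = d - k(1 + Σᵢ aᵢ)`, there is a nonzero polynomial function `F` on
`W_k × V^e` such that whenever `F ≠ 0` at `(p, c)`, the space `L` spanned by the tangent
spaces at the `k` decomposable tensors determined by `p` together with the `e` extra
vectors determined by `c` has dimension exactly `d`, and any decomposable tensor whose
tangent space lies in `L` is a scalar multiple of one of the `k` given ones. -/
def TangentGeneral (q : ℕ) (a : Fin q → ℕ) (k d : ℕ) : Prop :=
  ∃ F : MvPolynomial (WIdx q a k ⊕ (Fin (d - k * (1 + ∑ j, a j)) × BIdx q a)) ℂ,
    (∃ p c, evalWV F p c ≠ 0) ∧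
    ∀ p c, evalWV F p c ≠ 0 →
      (Module.finrank ℂ
          ↥((⨆ i, tangent a (p i)) ⊔
            Submodule.span ℂ (Set.range fun m => fromCoords a (c m))) = d ∧
       ∀ w : ∀ j : Fin q, Fin (a j + 1) → ℂ, (∀ j, w j ≠ 0) →
         tangent a w ≤
           (⨆ i, tangent a (p i)) ⊔
             Submodule.span ℂ (Set.range fun m => fromCoords a (c m)) →
         ∃ (i : Fin k) (t : ℂ), tprod ℂ w = t • tprod ℂ (p i))

section LinearAlgebra

open Module Submodule

/-- Adding the image of `f` to `L` raises the dimension by at most the codimension of any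
subspace that `f` maps into `L`. -/
theorem finrank_sup_range_add_le {K U V : Type*} [Field K] [AddCommGroup U] [Module K U]
    [FiniteDimensional K U] [AddCommGroup V] [Module K V] [FiniteDimensional K V]
    (f : U →ₗ[K] V) (L : Submodule K V) (K₀ : Submodule K U) (h : K₀ ≤ L.comap f) :
    finrank K ↥(L ⊔ LinearMap.range f) + finrank K K₀ ≤ finrank K L + finrank K U := by
  have h1 := (L.mkQ.domRestrict (L ⊔ LinearMap.range f)).finrank_range_add_finrank_ker
  have h2 := (L.mkQ ∘ₗ f).finrank_range_add_finrank_ker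
  have h3 : K₀ ≤ LinearMap.ker (L.mkQ ∘ₗ f) := by
    rw [LinearMap.ker_comp, ker_mkQ]; exact h
  have h4 := Submodule.finrank_mono h3
  have h5 : LinearMap.range (L.mkQ.domRestrict (L ⊔ LinearMap.range f))
      ≤ LinearMap.range (L.mkQ ∘ₗ f) := by
    rw [LinearMap.range_domRestrict, LinearMap.range_comp, Submodule.map_sup]
    simp
  have h6 := Submodule.finrank_mono h5
  have h7 : finrank K (LinearMap.ker (L.mkQ.domRestrict (L ⊔ LinearMap.range f)))
      ≤ finrank K L := by
    rw [LinearMap.ker_domRestrict, ker_mkQ]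
    have := Submodule.finrank_map_subtype_eq (L ⊔ LinearMap.range f)
      (L.comap (L ⊔ LinearMap.range f).subtype)
    change finrank K (L.comap (L ⊔ LinearMap.range f).subtype) ≤ _
    rw [← this]
    exact Submodule.finrank_mono (Submodule.map_comap_le _ _)
  omega

/-- Inside a spanning set one finds vectors that raise the dimension of a given subspace,
as long as there is room. -/
theorem exists_finrank_sup_span_ge {K V : Type*} [Field K] [AddCommGroup V] [Module K V]
    [FiniteDimensional K V] {J : Type*} [Fintype J] (Y : Set V) (hY : span K Y = ⊤)
    (U : Submodule K V) (r : ℕ) (hr : r ≤ finrank K U)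
    (hJ : r + Fintype.card J ≤ finrank K V) :
    ∃ y : J → V, (∀ i, y i ∈ Y) ∧
      r + Fintype.card J ≤ finrank K ↥(U ⊔ span K (Set.range y)) := by
  suffices H : ∀ m : ℕ, r + m ≤ finrank K V → ∃ y : Fin m → V, (∀ i, y i ∈ Y) ∧
      r + m ≤ finrank K ↥(U ⊔ span K (Set.range y)) by
    obtain ⟨y, hy, h⟩ := H _ hJ
    refine ⟨y ∘ Fintype.equivFin J, fun i => hy _, ?_⟩
    rwa [Set.range_comp, Equiv.range_eq_univ, Set.image_univ]
  intro m
  induction m with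
  | zero => intro _; exact ⟨Fin.elim0, fun i => i.elim0, by
      exact hr.trans (Submodule.finrank_mono le_sup_left)⟩
  | succ m ih =>
    intro hm
    obtain ⟨y, hy, h⟩ := ih (by omega)
    by_cases hlt : r + (m + 1) ≤ finrank K ↥(U ⊔ span K (Set.range y))
    · have hne : Y.Nonempty := by
        by_contra hne
        rw [Set.not_nonempty_iff_eq_empty] at hne
        subst hne
        rw [span_empty] at hY
        have := finrank_top K V
        rw [← hY, finrank_bot] at this
        omega
      obtain ⟨y0, hy0⟩ := hne
      refine ⟨Fin.snoc y y0, ?_, hlt.trans (Submodule.finrank_mono ?_)⟩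
      · intro i; refine Fin.lastCases ?_ (fun i => ?_) i <;> simp [hy0, hy]
      · refine sup_le_sup_left (span_mono ?_) _
        rintro _ ⟨i, rfl⟩
        exact ⟨i.castSucc, by simp⟩
    · have hne : ∃ y0 ∈ Y, y0 ∉ U ⊔ span K (Set.range y) := by
        by_contra! hcon
        have : U ⊔ span K (Set.range y) = ⊤ := by
          rw [eq_top_iff, ← hY, span_le]; exact hcon
        rw [this, finrank_top] at hlt
        omega
      obtain ⟨y0, hy0, hn⟩ := hne
      refine ⟨Fin.snoc y y0, ?_, ?_⟩
      · intro i; refine Fin.lastCases ?_ (fun i => ?_) i <;> simp [hy0, hy]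
      · have hlt' : U ⊔ span K (Set.range y)
            < U ⊔ span K (Set.range (Fin.snoc y y0 : Fin (m + 1) → V)) := by
          refine lt_of_le_of_ne ?_ ?_
          · refine sup_le_sup_left (span_mono ?_) _
            rintro _ ⟨i, rfl⟩
            exact ⟨i.castSucc, by simp⟩
          · intro heq
            apply hn
            rw [heq]
            exact mem_sup_right (subset_span ⟨Fin.last m, by simp⟩)
        have := Submodule.finrank_lt_finrank_of_lt hlt'
        omega

/-- A family spanning a space of dimension at least `r` has `r` independent members. -/
theorem exists_linearIndependent_comp {K V ι : Type*} [Field K] [AddCommGroup V] [Module K V]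
    [FiniteDimensional K V] (v : ι → V) {r : ℕ} (h : r ≤ finrank K (span K (Set.range v))) :
    ∃ s : Fin r → ι, LinearIndependent K (v ∘ s) := by
  obtain ⟨f, hf, -, hli⟩ := exists_fun_fin_finrank_span_eq K (Set.range v)
  choose s hs using hf
  refine ⟨s ∘ Fin.castLE h, ?_⟩
  have : v ∘ s ∘ Fin.castLE h = f ∘ Fin.castLE h := by
    ext i; simp [hs]
  rw [this]
  exact hli.comp _ (Fin.castLE_injective h)

/-- Lower semicontinuity of rank: a lower bound on the rank of a polynomial matrix at one
point is witnessed by the nonvanishing of a single polynomial, over any field extension. -/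
theorem exists_polynomial_le_finrank {σ ι κ : Type*} [Finite κ]
    (M : ι → κ → MvPolynomial σ ℂ) (x₀ : σ → ℂ) {r : ℕ}
    (h : r ≤ finrank ℂ (span ℂ (Set.range fun i f => MvPolynomial.eval x₀ (M i f)))) :
    ∃ F : MvPolynomial σ ℂ, MvPolynomial.eval x₀ F ≠ 0 ∧
      ∀ (E : Type) [Field E] [Algebra ℂ E] (X : σ → E), MvPolynomial.aeval X F ≠ 0 →
        r ≤ finrank E (span E (Set.range fun i f => MvPolynomial.aeval X (M i f))) := by
  cases nonempty_fintype κ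
  obtain ⟨s, hs⟩ := exists_linearIndependent_comp _ h
  set B : Matrix (Fin r) κ ℂ := fun i f => MvPolynomial.eval x₀ (M (s i) f) with hB
  have hrank : B.rank = r := by
    rw [LinearIndependent.rank_matrix (M := B) hs, Fintype.card_fin]
  have hcols : r ≤ finrank ℂ (span ℂ (Set.range B.col)) := by
    rw [← Matrix.rank_eq_finrank_span_cols, hrank]
  obtain ⟨t, ht⟩ := exists_linearIndependent_comp _ hcols
  refine ⟨Matrix.det (Matrix.of fun i j => M (s i) (t j)), ?_, ?_⟩
  · have : MvPolynomial.eval x₀ (Matrix.det (Matrix.of fun i j => M (s i) (t j)))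
        = Matrix.det (B.submatrix id t) := by
      rw [RingHom.map_det]; rfl
    rw [this]
    have h1 : LinearIndependent ℂ (B.submatrix id t).col := ht
    rw [Matrix.linearIndependent_cols_iff_isUnit, Matrix.isUnit_iff_isUnit_det] at h1
    exact h1.ne_zero
  · intro E _ _ X hF
    set C : Matrix (Fin r) (Fin r) E := fun i j => MvPolynomial.aeval X (M (s i) (t j)) with hC
    have h0 : MvPolynomial.aeval X (Matrix.det (Matrix.of fun i j => M (s i) (t j))) = C.det := by
      rw [AlgHom.map_det]; rfl
    rw [h0] at hF
    have h1 : LinearIndependent E C.row := by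
      rw [Matrix.linearIndependent_rows_iff_isUnit, Matrix.isUnit_iff_isUnit_det]
      exact hF.isUnit
    have h2 : LinearIndependent E (fun (i : Fin r) (f : κ) => MvPolynomial.aeval X (M (s i) f)) := by
      refine LinearIndependent.of_comp (LinearMap.funLeft E E t) ?_
      exact h1
    have h3 := finrank_span_eq_card h2
    rw [Fintype.card_fin] at h3
    conv_lhs => rw [← h3]
    refine Submodule.finrank_mono (span_mono ?_)
    rintro _ ⟨i, rfl⟩
    exact ⟨s i, rfl⟩

end LinearAlgebra

section GenericSolutions

open MvPolynomial

/-- Derivations into a formally étale algebra extend uniquely; here only existence. -/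
theorem Derivation.exists_extension_of_formallyEtale {k R E : Type*} [CommRing k] [CommRing R]
    [CommRing E] [Algebra k R] [Algebra R E] [Algebra k E] [IsScalarTower k R E]
    [Algebra.FormallyEtale R E] (d : Derivation k R E) :
    ∃ D : Derivation k E E, ∀ x, D (algebraMap R E x) = d x := by
  let l : E ⊗[R] Ω[R⁄k] →ₗ[E] E := d.liftKaehlerDifferential.liftBaseChange E
  refine ⟨(l ∘ₗ (KaehlerDifferential.tensorKaehlerEquivOfFormallyEtale k R E).symm.toLinearMap).compDer
    (KaehlerDifferential.D k E), fun x => ?_⟩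
  change l ((KaehlerDifferential.tensorKaehlerEquivOfFormallyEtale k R E).symm
    (KaehlerDifferential.D k E (algebraMap R E x))) = _
  rw [KaehlerDifferential.tensorKaehlerEquivOfFormallyEtale_symm_D_algebraMap]
  simp [l]

/-- The coordinate derivations of a polynomial ring extend to finite extensions of its field of
fractions. -/
theorem exists_dual_derivations {σ : Type} [DecidableEq σ] (K E : Type) [Field K]
    [Algebra (MvPolynomial σ ℂ) K] [IsFractionRing (MvPolynomial σ ℂ) K] [Field E]
    [Algebra K E] [Algebra (MvPolynomial σ ℂ) E] [IsScalarTower (MvPolynomial σ ℂ) K E]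
    [Algebra ℂ E] [IsScalarTower ℂ (MvPolynomial σ ℂ) E] [Module.Finite K E] :
    ∃ D : σ → Derivation ℂ E E, ∀ s t,
      D s (algebraMap (MvPolynomial σ ℂ) E (X t)) = if s = t then 1 else 0 := by
  have : CharZero K := by
    let := (algebraMap (MvPolynomial σ ℂ) K).comp (algebraMap ℂ (MvPolynomial σ ℂ))
    exact charZero_of_injective_ringHom this.injective
  have : Algebra.IsSeparable K E := inferInstance
  have : Algebra.FormallyEtale K E := Algebra.FormallyEtale.of_isSeparable K E
  have : Algebra.FormallyEtale (MvPolynomial σ ℂ) K :=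
    Algebra.FormallyEtale.of_isLocalization (nonZeroDivisors (MvPolynomial σ ℂ))
  have : Algebra.FormallyEtale (MvPolynomial σ ℂ) E :=
    Algebra.FormallyEtale.comp (MvPolynomial σ ℂ) K E
  have hD : ∀ s : σ, ∃ D : Derivation ℂ E E, ∀ t : MvPolynomial σ ℂ,
      D (algebraMap (MvPolynomial σ ℂ) E t) =
        MvPolynomial.mkDerivation ℂ (Pi.single s (1 : E)) t := fun s =>
    Derivation.exists_extension_of_formallyEtale _
  choose D hD using hD
  refine ⟨D, fun s t => ?_⟩
  rw [hD, mkDerivation_X, Pi.single_apply]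
  simp [eq_comm]

/-- A polynomial system with parameters either has no solution for general parameter values, or
has a solution over an algebraic extension of the function field of the parameter space. The
coordinate derivations extend to such a field. -/
theorem exists_generic_solution {σ τ : Type} [Finite σ] [Finite τ] [DecidableEq σ]
    (S : Set (MvPolynomial (σ ⊕ τ) ℂ)) :
    (∃ F : MvPolynomial σ ℂ, F ≠ 0 ∧ ∀ x : σ → ℂ, eval x F ≠ 0 →
      ∀ y : τ → ℂ, ∃ g ∈ S, eval (Sum.elim x y) g ≠ 0) ∨
    ∃ (E : Type) (_ : Field E) (_ : Algebra ℂ E) (X : σ → E) (y : τ → E)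
      (D : σ → Derivation ℂ E E),
      (∀ F : MvPolynomial σ ℂ, F ≠ 0 → aeval X F ≠ 0) ∧
      (∀ s t, D s (X t) = if s = t then 1 else 0) ∧
      ∀ g ∈ S, aeval (Sum.elim X y) g = 0 := by
  let K := FractionRing (MvPolynomial σ ℂ)
  let ψ : MvPolynomial (σ ⊕ τ) ℂ →ₐ[ℂ] MvPolynomial τ (MvPolynomial σ ℂ) :=
    aeval (Sum.elim (fun s => C (X s)) X)
  let I : Ideal (MvPolynomial τ (MvPolynomial σ ℂ)) := Ideal.span (ψ '' S)
  let J : Ideal (MvPolynomial τ K) := I.map (MvPolynomial.map (algebraMap (MvPolynomial σ ℂ) K))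
  by_cases hJ : J = ⊤
  · left
    let : Algebra (MvPolynomial τ (MvPolynomial σ ℂ)) (MvPolynomial τ K) := algebraMvPolynomial
    have h1 : (1 : MvPolynomial τ K) ∈
        I.map (algebraMap (MvPolynomial τ (MvPolynomial σ ℂ)) (MvPolynomial τ K)) :=
      (Ideal.eq_top_iff_one _).1 hJ
    rw [IsLocalization.mem_map_algebraMap_iff ((nonZeroDivisors (MvPolynomial σ ℂ)).map
      (C : (MvPolynomial σ ℂ) →+* MvPolynomial τ (MvPolynomial σ ℂ)))] at h1
    obtain ⟨⟨⟨i, hi⟩, ⟨m, m', hm', rfl⟩⟩, h⟩ := h1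
    have h2 : C m' ∈ I := by
      have : i = C m' := by
        apply map_injective (algebraMap (MvPolynomial σ ℂ) K)
          (IsFractionRing.injective (MvPolynomial σ ℂ) K)
        rw [one_mul] at h
        exact h.symm
      exact this ▸ hi
    refine ⟨m', nonZeroDivisors.ne_zero hm', fun x hx y => ?_⟩
    by_contra! hcon
    let ε : MvPolynomial τ (MvPolynomial σ ℂ) →+* ℂ := eval₂Hom (eval x) y
    have hε : I ≤ RingHom.ker ε := by
      rw [Ideal.span_le]
      rintro _ ⟨g, hg, rfl⟩
      change ε (ψ g) = 0
      rw [← hcon g hg]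
      have : ε.comp (ψ : MvPolynomial (σ ⊕ τ) ℂ →+* MvPolynomial τ (MvPolynomial σ ℂ)) =
          eval (Sum.elim x y) := by
        apply MvPolynomial.ringHom_ext
        · intro r; simp [ψ, ε, MvPolynomial.algebraMap_apply]
        · rintro (s | t) <;> simp [ψ, ε]
      exact congrArg (fun f => f g) this
    apply hx
    have := hε h2
    simpa [ε] using this
  · right
    obtain ⟨𝔪, hmax, hle⟩ := Ideal.exists_le_maximal J hJ
    let E := MvPolynomial τ K ⧸ 𝔪
    let : Field E := Ideal.Quotient.field 𝔪
    have : Algebra.FiniteType K E := inferInstance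
    have : Module.Finite K E := finite_of_finite_type_of_isJacobsonRing K E
    obtain ⟨D, hD⟩ := exists_dual_derivations (σ := σ) K E
    have hinj : Function.Injective (algebraMap (MvPolynomial σ ℂ) E) := by
      rw [IsScalarTower.algebraMap_eq (MvPolynomial σ ℂ) K E]
      exact (algebraMap K E).injective.comp (IsFractionRing.injective (MvPolynomial σ ℂ) K)
    have haev : ∀ F : MvPolynomial σ ℂ,
        aeval (fun s => algebraMap (MvPolynomial σ ℂ) E (X s)) F = algebraMap (MvPolynomial σ ℂ) E F := by
      intro F
      have : (aeval fun s => algebraMap (MvPolynomial σ ℂ) E (X s)) =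
          IsScalarTower.toAlgHom ℂ (MvPolynomial σ ℂ) E := by
        apply MvPolynomial.algHom_ext; intro s; simp
      rw [this]; rfl
    refine ⟨E, inferInstance, inferInstance, fun s => algebraMap (MvPolynomial σ ℂ) E (X s),
      fun t => Ideal.Quotient.mk 𝔪 (X t), D, ?_, hD, ?_⟩
    · intro F hF
      rw [haev]
      exact fun h => hF (hinj (by rw [h, map_zero]))
    · intro g hg
      have h1 : MvPolynomial.map (algebraMap (MvPolynomial σ ℂ) K) (ψ g) ∈ 𝔪 :=
        hle (Ideal.mem_map_of_mem _ (Ideal.subset_span ⟨g, hg, rfl⟩))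
      rw [← Ideal.Quotient.eq_zero_iff_mem] at h1
      rw [← h1]
      have : (aeval (Sum.elim (fun s => algebraMap (MvPolynomial σ ℂ) E (X s))
          fun t => Ideal.Quotient.mk 𝔪 (X t)) : _ →ₐ[ℂ] E).toRingHom =
        ((Ideal.Quotient.mk 𝔪).comp (MvPolynomial.map (algebraMap (MvPolynomial σ ℂ) K))).comp
          (ψ : MvPolynomial (σ ⊕ τ) ℂ →+* MvPolynomial τ (MvPolynomial σ ℂ)) := by
        apply MvPolynomial.ringHom_ext
        · intro r
          simp [ψ, MvPolynomial.algebraMap_apply]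
          rfl
        · rintro (s | t)
          · simp [ψ]; rfl
          · simp [ψ]
      exact congrArg (fun f => f g) this

end GenericSolutions

section SegreCone

open Module Submodule Function

theorem finrank_iSup_le_sum {K V ι : Type*} [Field K] [AddCommGroup V] [Module K V]
    [FiniteDimensional K V] [Fintype ι] (S : ι → Submodule K V) :
    finrank K ↥(⨆ i, S i) ≤ ∑ i, finrank K (S i) := by
  classical
  suffices H : ∀ s : Finset ι, finrank K ↥(s.sup S) ≤ ∑ i ∈ s, finrank K (S i) by
    rw [← Finset.sup_univ_eq_iSup]
    exact H Finset.univ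
  intro s
  induction s using Finset.induction_on with
  | empty => simp
  | insert i s hi ih =>
    rw [Finset.sup_insert, Finset.sum_insert hi]
    exact (Submodule.finrank_add_le_finrank_add_finrank _ _).trans (by omega)

theorem finrank_submodule_pi {K ι : Type*} [Field K] [Fintype ι] {V : ι → Type*}
    [∀ i, AddCommGroup (V i)] [∀ i, Module K (V i)] [∀ i, FiniteDimensional K (V i)]
    (S : ∀ i, Submodule K (V i)) :
    finrank K (Submodule.pi Set.univ S) = ∑ i, finrank K (S i) := by
  let e : Submodule.pi Set.univ S ≃ₗ[K] ∀ i, S i :=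
    { toFun := fun x i => ⟨x.1 i, x.2 i trivial⟩
      invFun := fun y => ⟨fun i => y i, fun i _ => (y i).2⟩
      map_add' := fun _ _ => rfl
      map_smul' := fun _ _ => rfl
      left_inv := fun _ => rfl
      right_inv := fun _ => rfl }
  rw [e.finrank_eq, finrank_pi_fintype]

/-- The Segre map in coordinates: `v ↦ (f ↦ ∏ j, v j (f j))`. -/
def seg {K : Type*} [CommRing K] {n a : ℕ} :
    MultilinearMap K (fun _ : Fin n => Fin (a + 1) → K) ((Fin n → Fin (a + 1)) → K) :=
  MultilinearMap.pi fun f =>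
    (MultilinearMap.mkPiAlgebra K (Fin n) K).compLinearMap fun j => LinearMap.proj (f j)

theorem seg_apply {K : Type*} [CommRing K] {n a : ℕ} (v : Fin n → Fin (a + 1) → K)
    (f : Fin n → Fin (a + 1)) : seg v f = ∏ j, v j (f j) := by
  simp [seg]

theorem map_seg {K K' : Type*} [CommRing K] [CommRing K'] {n a : ℕ} (φ : K →+* K')
    (v : Fin n → Fin (a + 1) → K) (f : Fin n → Fin (a + 1)) :
    φ (seg v f) = seg (fun j l => φ (v j l)) f := by
  simp [seg_apply]

/-- The derivative of the Segre map along the coordinate direction `x`. -/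
def segPartial {K : Type*} [CommRing K] {n a : ℕ} (v : Fin n → Fin (a + 1) → K)
    (x : Fin n × Fin (a + 1)) : (Fin n → Fin (a + 1)) → K :=
  seg (update v x.1 (Pi.single x.2 1))

theorem map_segPartial {K K' : Type*} [CommRing K] [CommRing K'] {n a : ℕ} (φ : K →+* K')
    (v : Fin n → Fin (a + 1) → K) (x : Fin n × Fin (a + 1)) (f : Fin n → Fin (a + 1)) :
    φ (segPartial v x f) = segPartial (fun j l => φ (v j l)) x f := by
  rw [segPartial, map_seg, segPartial]
  refine congrArg (fun w => seg w f) (funext fun j => funext fun l => ?_)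
  by_cases hj : j = x.1
  · subst hj
    rw [update_self, update_self, Pi.single_apply, Pi.single_apply]
    split_ifs <;> simp
  · rw [update_of_ne hj, update_of_ne hj]

variable {K : Type*} [Field K] {n a : ℕ}

/-- The affine tangent space to the Segre cone, in coordinates. -/
def segTan (v : Fin n → Fin (a + 1) → K) : Submodule K ((Fin n → Fin (a + 1)) → K) :=
  LinearMap.range (seg.linearDeriv v)

theorem linearDeriv_seg_mem (v y : Fin n → Fin (a + 1) → K) : seg.linearDeriv v y ∈ segTan v :=
  LinearMap.mem_range_self _ _

theorem seg_update_mem_segTan (v : Fin n → Fin (a + 1) → K) (j : Fin n) (u : Fin (a + 1) → K) :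
    seg (update v j u) ∈ segTan v := by
  refine ⟨Pi.single j u, ?_⟩
  rw [MultilinearMap.linearDeriv_apply, Finset.sum_eq_single j]
  · simp
  · intro i _ hi
    rw [Pi.single_eq_of_ne hi, MultilinearMap.map_update_zero]
  · simp

theorem seg_mem_segTan (hn : 0 < n) (v : Fin n → Fin (a + 1) → K) : seg v ∈ segTan v := by
  simpa using seg_update_mem_segTan v ⟨0, hn⟩ (v ⟨0, hn⟩)

theorem segTan_le_iff {v : Fin n → Fin (a + 1) → K}
    {L : Submodule K ((Fin n → Fin (a + 1)) → K)} :
    segTan v ≤ L ↔ ∀ j u, seg (update v j u) ∈ L := by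
  refine ⟨fun h j u => h (seg_update_mem_segTan v j u), fun h => ?_⟩
  rintro _ ⟨y, rfl⟩
  rw [MultilinearMap.linearDeriv_apply]
  exact Submodule.sum_mem _ fun j _ => h j (y j)

theorem segTan_eq_span (v : Fin n → Fin (a + 1) → K) :
    segTan v = span K (Set.range (segPartial v)) := by
  apply le_antisymm
  · rw [segTan_le_iff]
    intro j u
    change seg.toLinearMap v j u ∈ _
    rw [pi_eq_sum_univ' u, map_sum]
    refine Submodule.sum_mem _ fun l _ => ?_
    rw [map_smul]
    refine Submodule.smul_mem _ _ (subset_span ⟨(j, l), ?_⟩)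
    rfl
  · rw [span_le]
    rintro _ ⟨x, rfl⟩
    exact seg_update_mem_segTan _ _ _

theorem finrank_segTan_le (hn : 0 < n) (v : Fin n → Fin (a + 1) → K) :
    finrank K (segTan v) ≤ a * n + 1 := by
  by_cases hv : ∃ j, v j = 0
  · obtain ⟨j, hj⟩ := hv
    have h1 : segTan v ≤ LinearMap.range (seg.toLinearMap v j) := by
      rw [segTan_le_iff]
      intro i u
      by_cases hi : i = j
      · subst hi; exact ⟨u, rfl⟩
      · have : seg (update v i u) = 0 :=
          MultilinearMap.map_coord_zero _ j (by rw [update_of_ne (Ne.symm hi), hj])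
        rw [this]; exact zero_mem _
    have h2 := Submodule.finrank_mono h1
    have h3 := LinearMap.finrank_range_le (seg.toLinearMap v j)
    rw [finrank_fin_fun] at h3
    have h4 : a * 1 ≤ a * n := Nat.mul_le_mul_left a hn
    omega
  · push Not at hv
    have h := finrank_sup_range_add_le (seg.linearDeriv v) (span K {seg v})
      (Submodule.pi Set.univ fun j => span K {v j}) ?_
    · rw [finrank_submodule_pi, finrank_pi_fintype] at h
      simp only [finrank_fin_fun, finrank_span_singleton (hv _), Finset.sum_const,
        Finset.card_univ, Fintype.card_fin, smul_eq_mul, mul_one] at h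
      have h1 : finrank K (span K {seg v}) ≤ 1 := by
        simpa using finrank_span_le_card (R := K) {seg v}
      have h2 := Submodule.finrank_mono (le_sup_right : segTan v ≤ span K {seg v} ⊔ segTan v)
      change finrank K ↥(span K {seg v} ⊔ segTan v) + n ≤ _ at h
      have h3 : n * (a + 1) = a * n + n := by ring
      omega
    · intro y hy
      rw [mem_comap, MultilinearMap.linearDeriv_apply]
      refine Submodule.sum_mem _ fun j _ => ?_
      obtain ⟨c, hc⟩ := mem_span_singleton.1 (hy j trivial)
      rw [← hc, MultilinearMap.map_update_smul, update_eq_self]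
      exact Submodule.smul_mem _ _ (mem_span_singleton_self _)

theorem finrank_singleton_complement_sum (hn : 0 < n) (p : Fin n → Fin (a + 1) → K)
    (hp : ∀ j, p j ≠ 0) (j₀ : Fin n) :
    finrank K (Submodule.pi Set.univ fun j => if j = j₀ then ⊤ else span K {p j}) = a + n := by
  rw [finrank_submodule_pi, ← Finset.add_sum_erase _ _ (Finset.mem_univ j₀),
    Finset.sum_congr rfl (g := fun _ => 1)]
  · rw [if_pos rfl, finrank_top]
    simp; omega
  · intro j hj
    rw [if_neg (Finset.ne_of_mem_erase hj), finrank_span_singleton (hp j)]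

theorem pi_le_comap_linearDeriv (p : Fin n → Fin (a + 1) → K) (j₀ : Fin n) (u : Fin (a + 1) → K)
    (L : Submodule K ((Fin n → Fin (a + 1)) → K)) (hL : segTan p ≤ L) :
    (Submodule.pi Set.univ fun j => if j = j₀ then ⊤ else span K {p j}) ≤
      L.comap (seg.linearDeriv (update p j₀ u)) := by
  intro y hy
  rw [mem_comap, MultilinearMap.linearDeriv_apply]
  refine Submodule.sum_mem _ fun j _ => ?_
  by_cases hj : j = j₀
  · subst hj
    rw [update_idem]
    exact hL (seg_update_mem_segTan _ _ _)
  · have := hy j trivial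
    simp only [if_neg hj] at this
    obtain ⟨c, hc⟩ := mem_span_singleton.1 this
    rw [← hc, MultilinearMap.map_update_smul, update_comm (Ne.symm hj), update_eq_self]
    exact Submodule.smul_mem _ _ (hL (seg_update_mem_segTan _ _ _))

theorem finrank_sup_segTan_update_le (hn : 0 < n) (p : Fin n → Fin (a + 1) → K)
    (hp : ∀ j, p j ≠ 0) (j₀ : Fin n) (u : Fin (a + 1) → K)
    (L : Submodule K ((Fin n → Fin (a + 1)) → K)) (hL : segTan p ≤ L) :
    finrank K ↥(L ⊔ segTan (update p j₀ u)) ≤ finrank K L + a * (n - 1) := by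
  have h := finrank_sup_range_add_le _ L _ (pi_le_comap_linearDeriv p j₀ u L hL)
  rw [finrank_singleton_complement_sum hn p hp, finrank_pi_fintype] at h
  simp only [finrank_fin_fun, Finset.sum_const, Finset.card_univ, Fintype.card_fin,
    smul_eq_mul] at h
  change finrank K ↥(L ⊔ segTan (update p j₀ u)) + _ ≤ _ at h
  obtain ⟨m, rfl⟩ : ∃ m, n = m + 1 := ⟨n - 1, by omega⟩
  have : (m + 1) * (a + 1) = a * m + (a + (m + 1)) := by ring
  simp only [Nat.add_sub_cancel]
  omega

/-- If moving the factor `j₀` of `p` makes the tangent space as transverse to `L` as possible,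
then a tangent vector at the moved point lies in `L` only for obvious reasons. -/
theorem mem_span_of_linearDeriv_mem (hn : 0 < n) (p : Fin n → Fin (a + 1) → K)
    (hp : ∀ j, p j ≠ 0) (j₀ : Fin n) (u : Fin (a + 1) → K)
    (L : Submodule K ((Fin n → Fin (a + 1)) → K)) (hL : segTan p ≤ L)
    (hrank : finrank K L + a * (n - 1) ≤ finrank K ↥(L ⊔ segTan (update p j₀ u)))
    (v : Fin n → Fin (a + 1) → K) (hv : seg.linearDeriv (update p j₀ u) v ∈ L)
    (j : Fin n) (hj : j ≠ j₀) : v j ∈ span K {p j} := by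
  have h := finrank_sup_range_add_le (seg.linearDeriv (update p j₀ u)) L _ le_rfl
  have hfin := finrank_singleton_complement_sum hn p hp j₀
  have heq := Submodule.eq_of_le_of_finrank_le (pi_le_comap_linearDeriv p j₀ u L hL) (by
    rw [hfin]
    rw [finrank_pi_fintype] at h
    simp only [finrank_fin_fun, Finset.sum_const, Finset.card_univ, Fintype.card_fin,
      smul_eq_mul] at h
    change finrank K ↥(L ⊔ segTan (update p j₀ u)) + _ ≤ _ at h
    obtain ⟨m, rfl⟩ : ∃ m, n = m + 1 := ⟨n - 1, by omega⟩
    have : (m + 1) * (a + 1) = a * m + (a + (m + 1)) := by ring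
    simp only [Nat.add_sub_cancel] at hrank
    omega)
  have hmem : v ∈ L.comap (seg.linearDeriv (update p j₀ u)) := hv
  rw [← heq] at hmem
  simpa [hj] using hmem j trivial

theorem Derivation.map_finset_prod {k E ι : Type*} [CommRing k] [CommRing E] [Algebra k E]
    [DecidableEq ι] (D : Derivation k E E) (s : Finset ι) (g : ι → E) :
    D (∏ i ∈ s, g i) = ∑ i ∈ s, D (g i) * ∏ j ∈ s.erase i, g j := by
  induction s using Finset.induction_on with
  | empty => simp
  | insert i s hi ih =>
    rw [Finset.prod_insert hi, D.leibniz, ih, Finset.sum_insert hi, Finset.erase_insert hi,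
      smul_eq_mul, smul_eq_mul, Finset.mul_sum, add_comm, mul_comm]
    congr 1
    refine Finset.sum_congr rfl fun j hj => ?_
    have hij : i ≠ j := fun h => hi (h ▸ hj)
    rw [Finset.erase_insert_of_ne hij, Finset.prod_insert (fun h => hi (Finset.mem_of_mem_erase h))]
    ring

theorem derivation_comp_seg [Algebra ℂ K] (D : Derivation ℂ K K) (w : Fin n → Fin (a + 1) → K) :
    D ∘ seg w = seg.linearDeriv w fun j => D ∘ w j := by
  ext f
  rw [comp_apply, seg_apply, Derivation.map_finset_prod, MultilinearMap.linearDeriv_apply,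
    Finset.sum_apply]
  refine Finset.sum_congr rfl fun j _ => ?_
  rw [seg_apply, ← Finset.mul_prod_erase _ _ (Finset.mem_univ j), update_self]
  congr 1
  refine Finset.prod_congr rfl fun i hi => ?_
  rw [update_of_ne (Finset.ne_of_mem_erase hi)]

theorem derivation_comp_sum {ι κ : Type*} [Algebra ℂ K] (D : Derivation ℂ K K) (s : Finset ι)
    (g : ι → κ → K) : D ∘ (∑ i ∈ s, g i) = ∑ i ∈ s, D ∘ g i := by
  ext f; simp

theorem derivation_comp_smul {κ : Type*} [Algebra ℂ K] (D : Derivation ℂ K K) (c : K)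
    (g : κ → K) : D ∘ (c • g) = D c • g + c • (D ∘ g) := by
  ext f; simp [mul_comm]; ring

/-- Differentiating a tangent vector at `p`: modulo the tangent space at `p`, only the terms that
move two different factors survive. -/
theorem derivation_comp_linearDeriv_sub_mem [Algebra ℂ K] (D : Derivation ℂ K K)
    (p v : Fin n → Fin (a + 1) → K) :
    D ∘ seg.linearDeriv p v - ∑ j, ∑ i ∈ Finset.univ.erase j,
      seg (update (update p j (v j)) i (D ∘ p i)) ∈ segTan p := by
  rw [MultilinearMap.linearDeriv_apply, derivation_comp_sum, ← Finset.sum_sub_distrib]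
  refine Submodule.sum_mem _ fun j _ => ?_
  rw [derivation_comp_seg, MultilinearMap.linearDeriv_apply,
    ← Finset.add_sum_erase _ _ (Finset.mem_univ j)]
  rw [update_idem, Finset.sum_congr rfl (g := fun i =>
    seg (update (update p j (v j)) i (D ∘ p i))), add_sub_cancel_right]
  · exact seg_update_mem_segTan _ _ _
  · intro i hi
    rw [update_of_ne (Finset.ne_of_mem_erase hi)]

end SegreCone

section Core

open Module Submodule Function

variable {K : Type*} [Field K] {n a k e : ℕ}

/-- The span of the tangent spaces at the points `p` and of the extra vectors `c`. -/
def tanSpan (p : Fin k → Fin n → Fin (a + 1) → K) (c : Fin e → (Fin n → Fin (a + 1)) → K) :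
    Submodule K ((Fin n → Fin (a + 1)) → K) :=
  (⨆ i, segTan (p i)) ⊔ span K (Set.range c)

theorem segTan_le_tanSpan (p : Fin k → Fin n → Fin (a + 1) → K)
    (c : Fin e → (Fin n → Fin (a + 1)) → K) (i : Fin k) : segTan (p i) ≤ tanSpan p c :=
  (le_iSup (fun i => segTan (p i)) i).trans le_sup_left

theorem finrank_iSup_segTan_le (hn : 0 < n) (p : Fin k → Fin n → Fin (a + 1) → K) :
    finrank K ↥(⨆ i, segTan (p i)) ≤ k * (a * n + 1) := by
  refine (finrank_iSup_le_sum _).trans ?_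
  refine (Finset.sum_le_card_nsmul _ _ _ fun i _ => finrank_segTan_le hn (p i)).trans ?_
  simp

theorem finrank_tanSpan_le_add (p : Fin k → Fin n → Fin (a + 1) → K)
    (c : Fin e → (Fin n → Fin (a + 1)) → K) :
    finrank K ↥(tanSpan p c) ≤ finrank K ↥(⨆ i, segTan (p i)) + e := by
  refine (Submodule.finrank_add_le_finrank_add_finrank _ _).trans ?_
  have := finrank_range_le_card (R := K) c
  rw [Fintype.card_fin] at this
  exact Nat.add_le_add_left this _

/-- A configuration whose tangent span is as large as possible, and stays so after moving one
factor of one of the points. -/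
structure GoodConfig (p : Fin k → Fin n → Fin (a + 1) → K)
    (c : Fin e → (Fin n → Fin (a + 1)) → K) : Prop where
  ne_zero : ∀ i j, p i j ≠ 0
  le_finrank : ∀ i j₀, ∃ u, k * (a * n + 1) + e + a * (n - 1) ≤
    finrank K ↥(tanSpan p c ⊔ segTan (update (p i) j₀ u))

namespace GoodConfig

variable {p : Fin k → Fin n → Fin (a + 1) → K} {c : Fin e → (Fin n → Fin (a + 1)) → K}

theorem finrank_tanSpan (h : GoodConfig p c) (hk : 0 < k) (hn : 0 < n) :
    finrank K (tanSpan p c) = k * (a * n + 1) + e := by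
  obtain ⟨u, hu⟩ := h.le_finrank ⟨0, hk⟩ ⟨0, hn⟩
  have h1 := finrank_sup_segTan_update_le hn (p ⟨0, hk⟩) (h.ne_zero _) ⟨0, hn⟩ u _
    (segTan_le_tanSpan p c _)
  have h2 := finrank_tanSpan_le_add p c
  have h3 := finrank_iSup_segTan_le hn p
  omega

theorem finrank_iSup (h : GoodConfig p c) (hk : 0 < k) (hn : 0 < n) :
    finrank K ↥(⨆ i, segTan (p i)) = k * (a * n + 1) := by
  have h1 := h.finrank_tanSpan hk hn
  have h2 := finrank_tanSpan_le_add p c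
  have h3 := finrank_iSup_segTan_le hn p
  omega

theorem tanSpan_ne_top (h : GoodConfig p c) (hk : 0 < k) (hn : 1 < n) (ha : 0 < a) :
    tanSpan p c ≠ ⊤ := by
  intro htop
  obtain ⟨u, hu⟩ := h.le_finrank ⟨0, hk⟩ ⟨0, by omega⟩
  have h1 := h.finrank_tanSpan hk (by omega)
  rw [htop] at h1 hu
  rw [top_sup_eq] at hu
  have : 0 < a * (n - 1) := Nat.mul_pos ha (by omega)
  omega

/-- The points of a good configuration are linearly independent. -/
theorem linearIndependent_seg (h : GoodConfig p c) (hk : 0 < k) (hn : 0 < n) :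
    LinearIndependent K fun i => seg (p i) := by
  rw [linearIndependent_iff_card_le_finrank_span, Set.finrank, Fintype.card_fin]
  have h1 := h.finrank_iSup hk hn
  have h2 : ⨆ i, segTan (p i) ≤ span K (Set.range fun i => seg (p i)) ⊔ LinearMap.range
      (LinearMap.lsum K (fun _ : Fin k => Fin n → Fin (a + 1) → K) K
        fun i => seg.linearDeriv (p i)) := by
    refine iSup_le fun i => le_trans ?_ le_sup_right
    rintro _ ⟨y, rfl⟩
    refine ⟨Pi.single i y, ?_⟩
    rw [LinearMap.lsum_apply, LinearMap.sum_apply, Finset.sum_eq_single i]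
    · rw [LinearMap.comp_apply, LinearMap.proj_apply, Pi.single_eq_same]
    · intro j _ hj
      rw [LinearMap.comp_apply, LinearMap.proj_apply, Pi.single_eq_of_ne hj, map_zero]
    · simp
  have h3 := finrank_sup_range_add_le (LinearMap.lsum K (fun _ : Fin k => Fin n → Fin (a + 1) → K) K
        fun i => seg.linearDeriv (p i)) (span K (Set.range fun i => seg (p i)))
        (Submodule.pi Set.univ fun i => Submodule.pi Set.univ fun j => span K {p i j}) ?_
  · have h4 := Submodule.finrank_mono h2
    rw [finrank_submodule_pi, finrank_pi_fintype] at h3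
    simp only [finrank_submodule_pi, finrank_pi_fintype, finrank_self,
      finrank_span_singleton (h.ne_zero _ _), Finset.sum_const,
      Finset.card_univ, Fintype.card_fin, smul_eq_mul, mul_one] at h3
    have h5 : k * (n * (a + 1)) = k * (a * n + 1) + k * n - k := by
      have : k * (n * (a + 1)) + k = k * (a * n + 1) + k * n := by ring
      omega
    have h6 : k ≤ k * n := Nat.le_mul_of_pos_right k hn
    omega
  · intro y hy
    rw [mem_comap, LinearMap.lsum_apply, LinearMap.sum_apply]
    refine Submodule.sum_mem _ fun i _ => ?_
    rw [LinearMap.comp_apply, LinearMap.proj_apply, MultilinearMap.linearDeriv_apply]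
    refine Submodule.sum_mem _ fun j _ => ?_
    obtain ⟨c, hc⟩ := mem_span_singleton.1 (hy i trivial j trivial)
    rw [← hc, MultilinearMap.map_update_smul, update_eq_self]
    exact Submodule.smul_mem _ _ (subset_span ⟨i, rfl⟩)

end GoodConfig

/-- Derivations can prescribe arbitrary derivatives for all coordinates of `p` and `c`. -/
def HasFreeDirections [Algebra ℂ K] (p : Fin k → Fin n → Fin (a + 1) → K)
    (c : Fin e → (Fin n → Fin (a + 1)) → K) : Prop :=
  ∀ (y : Fin k → Fin n → Fin (a + 1) → K) (g : Fin e → (Fin n → Fin (a + 1)) → K),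
    ∃ D : Derivation ℂ K K, (∀ i j, D ∘ p i j = y i j) ∧ ∀ m, D ∘ c m = g m

theorem exists_eq_sum_of_mem_tanSpan {p : Fin k → Fin n → Fin (a + 1) → K}
    {c : Fin e → (Fin n → Fin (a + 1)) → K} {x : (Fin n → Fin (a + 1)) → K}
    (hx : x ∈ tanSpan p c) : ∃ (v : Fin k → Fin n → Fin (a + 1) → K) (b : Fin e → K),
      x = ∑ i, seg.linearDeriv (p i) (v i) + ∑ m, b m • c m := by
  obtain ⟨y, hy, z, hz, rfl⟩ := mem_sup.1 hx
  obtain ⟨b, hb⟩ := (mem_span_range_iff_exists_fun K).1 hz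
  obtain ⟨μ, hμ⟩ := (mem_iSup_iff_exists_finsupp _ _).1 hy
  choose v hv using hμ.1
  refine ⟨v, b, ?_⟩
  rw [hb, ← hμ.2, Finsupp.sum_fintype _ _ (fun _ => rfl)]
  simp [hv]

variable [Algebra ℂ K]

/-- A tangent vector at a general configuration that is a point of the Segre cone whose tangent
space lies in the tangent span has no component along the extra vectors. -/
theorem coeff_eq_zero_of_segTan_le {p : Fin k → Fin n → Fin (a + 1) → K}
    {c : Fin e → (Fin n → Fin (a + 1)) → K} (hD : HasFreeDirections p c)
    (htop : tanSpan p c ≠ ⊤) {w : Fin n → Fin (a + 1) → K} (hw : segTan w ≤ tanSpan p c)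
    {v : Fin k → Fin n → Fin (a + 1) → K} {b : Fin e → K}
    (h : seg w = ∑ i, seg.linearDeriv (p i) (v i) + ∑ m, b m • c m) (m₀ : Fin e) :
    b m₀ = 0 := by
  by_contra hb
  apply htop
  rw [eq_top_iff]
  rintro g -
  obtain ⟨D, hDp, hDc⟩ := hD 0 (Pi.single m₀ g)
  have h1 : D ∘ seg w ∈ tanSpan p c := by
    rw [derivation_comp_seg]; exact hw (linearDeriv_seg_mem _ _)
  have h2 : D ∘ seg w = ∑ i, D ∘ seg.linearDeriv (p i) (v i)
      + (∑ m, D (b m) • c m + b m₀ • g) := by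
    have : D ∘ seg w = D ∘ (∑ i, seg.linearDeriv (p i) (v i)) + D ∘ (∑ m, b m • c m) := by
      rw [h]; ext f; simp
    rw [this, derivation_comp_sum, derivation_comp_sum]
    congr 1
    rw [Finset.sum_congr rfl fun m _ => derivation_comp_smul D (b m) (c m),
      Finset.sum_add_distrib]
    congr 1
    rw [Finset.sum_eq_single m₀]
    · rw [hDc, Pi.single_eq_same]
    · intro m _ hm
      rw [hDc, Pi.single_eq_of_ne hm, smul_zero]
    · simp
  have h3 : ∑ i, D ∘ seg.linearDeriv (p i) (v i) ∈ tanSpan p c := by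
    refine Submodule.sum_mem _ fun i _ => segTan_le_tanSpan p c i ?_
    have := derivation_comp_linearDeriv_sub_mem D (p i) (v i)
    rwa [Finset.sum_eq_zero, sub_zero] at this
    intro j _
    refine Finset.sum_eq_zero fun j' _ => ?_
    rw [hDp]
    exact MultilinearMap.map_update_zero _ _ _
  have h4 : ∑ m, D (b m) • c m ∈ tanSpan p c :=
    Submodule.sum_mem _ fun m _ => Submodule.smul_mem _ _
      (mem_sup_right (subset_span ⟨m, rfl⟩))
  rw [h2] at h1
  have h5 := ((tanSpan p c).add_mem_iff_right h4).1 (((tanSpan p c).add_mem_iff_right h3).1 h1)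
  exact ((tanSpan p c).smul_mem_iff hb).1 h5

theorem linearDeriv_update_mem_of_segTan_le {p : Fin k → Fin n → Fin (a + 1) → K}
    {c : Fin e → (Fin n → Fin (a + 1)) → K} (hD : HasFreeDirections p c)
    {w : Fin n → Fin (a + 1) → K} (hw : segTan w ≤ tanSpan p c)
    {v : Fin k → Fin n → Fin (a + 1) → K} (h : seg w = ∑ i, seg.linearDeriv (p i) (v i))
    (i₀ : Fin k) (j₀ : Fin n) (u : Fin (a + 1) → K) :
    seg.linearDeriv (update (p i₀) j₀ u) (v i₀) ∈ tanSpan p c := by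
  obtain ⟨D, hDp, -⟩ := hD (Pi.single i₀ (Pi.single j₀ u)) 0
  have h1 : D ∘ seg w ∈ tanSpan p c := by
    rw [derivation_comp_seg]; exact hw (linearDeriv_seg_mem _ _)
  rw [h, derivation_comp_sum, ← Finset.add_sum_erase _ _ (Finset.mem_univ i₀)] at h1
  have h2 : ∑ i ∈ Finset.univ.erase i₀, D ∘ seg.linearDeriv (p i) (v i) ∈ tanSpan p c := by
    refine Submodule.sum_mem _ fun i hi => segTan_le_tanSpan p c i ?_
    have := derivation_comp_linearDeriv_sub_mem D (p i) (v i)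
    rwa [Finset.sum_eq_zero, sub_zero] at this
    intro j _
    refine Finset.sum_eq_zero fun j' _ => ?_
    rw [hDp, Pi.single_eq_of_ne (Finset.ne_of_mem_erase hi)]
    exact MultilinearMap.map_update_zero _ _ _
  have h3 := ((tanSpan p c).add_mem_iff_left h2).1 h1
  have h4 := segTan_le_tanSpan p c i₀ (derivation_comp_linearDeriv_sub_mem D (p i₀) (v i₀))
  have h5 := (tanSpan p c).sub_mem h3 h4
  rw [sub_sub_cancel, ← Finset.add_sum_erase _ _ (Finset.mem_univ j₀),
    Finset.sum_eq_zero (s := Finset.univ.erase j₀), zero_add] at h5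
  · rw [MultilinearMap.linearDeriv_apply, ← Finset.add_sum_erase _ _ (Finset.mem_univ j₀),
      update_idem]
    refine Submodule.add_mem _ (segTan_le_tanSpan p c i₀ (seg_update_mem_segTan _ _ _)) ?_
    convert h5 using 1
    refine Finset.sum_congr rfl fun j hj => ?_
    have hj' := Finset.ne_of_mem_erase hj
    rw [← Finset.sum_subset (Finset.singleton_subset_iff.2
      (Finset.mem_erase.2 ⟨hj'.symm, Finset.mem_univ j₀⟩))]
    · rw [Finset.sum_singleton, hDp, Pi.single_eq_same, Pi.single_eq_same, update_comm hj'.symm]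
    · intro j' _ hj'
      rw [hDp, Pi.single_eq_same, Pi.single_eq_of_ne (by simpa using hj')]
      exact MultilinearMap.map_update_zero _ _ _
  · intro j hj
    rw [hDp, Pi.single_eq_same, Pi.single_eq_of_ne (Finset.ne_of_mem_erase hj)]
    exact MultilinearMap.map_update_zero _ _ _

/-- A point whose tangent space lies in the tangent span of a general configuration is a linear
combination of the points of the configuration. -/
theorem GoodConfig.exists_eq_sum_seg {p : Fin k → Fin n → Fin (a + 1) → K}
    {c : Fin e → (Fin n → Fin (a + 1)) → K} (hg : GoodConfig p c) (hD : HasFreeDirections p c)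
    (hk : 0 < k) (hn : 1 < n) (ha : 0 < a) {w : Fin n → Fin (a + 1) → K}
    (hw : segTan w ≤ tanSpan p c) : ∃ γ : Fin k → K, seg w = ∑ i, γ i • seg (p i) := by
  obtain ⟨v, b, h⟩ := exists_eq_sum_of_mem_tanSpan (hw (seg_mem_segTan (by omega) w))
  have hb := coeff_eq_zero_of_segTan_le hD (hg.tanSpan_ne_top hk hn ha) hw h
  simp only [hb, zero_smul, Finset.sum_const_zero, add_zero] at h
  have hv : ∀ i j, v i j ∈ span K {p i j} := by
    intro i j
    obtain ⟨j₀, hj₀⟩ : ∃ j₀ : Fin n, j ≠ j₀ := by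
      have : Nontrivial (Fin n) := Fin.nontrivial_iff_two_le.2 hn
      obtain ⟨j₀, hj₀⟩ := exists_ne j
      exact ⟨j₀, hj₀.symm⟩
    obtain ⟨u, hu⟩ := hg.le_finrank i j₀
    rw [← hg.finrank_tanSpan hk (by omega)] at hu
    exact mem_span_of_linearDeriv_mem (by omega) (p i) (hg.ne_zero i) j₀ u _
      (segTan_le_tanSpan p c i) hu _ (linearDeriv_update_mem_of_segTan_le hD hw h i j₀ u) j hj₀
  choose γ hγ using fun i j => mem_span_singleton.1 (hv i j)
  refine ⟨fun i => ∑ j, γ i j, ?_⟩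
  rw [h]
  refine Finset.sum_congr rfl fun i _ => ?_
  rw [MultilinearMap.linearDeriv_apply, Finset.sum_smul]
  refine Finset.sum_congr rfl fun j _ => ?_
  rw [← hγ, MultilinearMap.map_update_smul, update_eq_self]

theorem segTan_le_of_eq_sum {p : Fin k → Fin n → Fin (a + 1) → K}
    {c : Fin e → (Fin n → Fin (a + 1)) → K} (hD : HasFreeDirections p c)
    {w : Fin n → Fin (a + 1) → K} {γ : Fin k → K} (h : seg w = ∑ i, γ i • seg (p i))
    (i₀ : Fin k) (hi₀ : γ i₀ ≠ 0) :
    segTan (p i₀) ≤ segTan w ⊔ span K (Set.range fun i => seg (p i)) := by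
  rintro _ ⟨y, rfl⟩
  obtain ⟨D, hDp, -⟩ := hD (Pi.single i₀ y) 0
  have h1 : D ∘ seg w ∈ segTan w := by
    rw [derivation_comp_seg]; exact linearDeriv_seg_mem _ _
  have h2 : D ∘ seg w = ∑ i, D (γ i) • seg (p i) + γ i₀ • seg.linearDeriv (p i₀) y := by
    rw [h, derivation_comp_sum, Finset.sum_congr rfl fun m _ => derivation_comp_smul D (γ m) _,
      Finset.sum_add_distrib, Finset.sum_eq_single i₀ (f := fun i => γ i • (D ∘ seg (p i)))]
    · rw [derivation_comp_seg]
      simp only [hDp, Pi.single_eq_same]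
    · intro i _ hi
      rw [derivation_comp_seg]
      simp only [hDp, Pi.single_eq_of_ne hi]
      have : (fun j : Fin n => (0 : Fin n → Fin (a + 1) → K) j) = 0 := rfl
      rw [this, map_zero, smul_zero]
    · simp
  have h3 : γ i₀ • seg.linearDeriv (p i₀) y = D ∘ seg w - ∑ i, D (γ i) • seg (p i) := by
    rw [h2]; abel
  refine (Submodule.smul_mem_iff _ hi₀).1 ?_
  rw [h3]
  refine Submodule.sub_mem _ (mem_sup_left h1) (mem_sup_right ?_)
  exact Submodule.sum_mem _ fun i _ => Submodule.smul_mem _ _ (subset_span ⟨i, rfl⟩)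

/-- A general tangent span is tangent to the Segre cone only along the given points. -/
theorem GoodConfig.exists_eq_smul_seg {p : Fin k → Fin n → Fin (a + 1) → K}
    {c : Fin e → (Fin n → Fin (a + 1)) → K} (hg : GoodConfig p c) (hD : HasFreeDirections p c)
    (hk : 0 < k) (hn : 1 < n) (ha : 0 < a) {w : Fin n → Fin (a + 1) → K}
    (hw : segTan w ≤ tanSpan p c) : ∃ (i : Fin k) (t : K), seg w = t • seg (p i) := by
  obtain ⟨γ, hγ⟩ := hg.exists_eq_sum_seg hD hk hn ha hw
  by_cases h0 : ∃ i₁ i₂, i₁ ≠ i₂ ∧ γ i₁ ≠ 0 ∧ γ i₂ ≠ 0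
  · exfalso
    obtain ⟨i₁, i₂, hne, h1, h2⟩ := h0
    set N : Submodule K ((Fin n → Fin (a + 1)) → K) :=
      ⨆ i, if i = i₁ then segTan w else if i = i₂ then span K {seg (p i₂)} else segTan (p i)
      with hN
    have hle : ∀ i, (if i = i₁ then segTan w else if i = i₂ then span K {seg (p i₂)}
        else segTan (p i)) ≤ N := fun i => le_iSup (fun i => if i = i₁ then segTan w else
          if i = i₂ then span K {seg (p i₂)} else segTan (p i)) i
    have hwN : segTan w ≤ N := by simpa using hle i₁
    have hother : ∀ i, i ≠ i₁ → seg (p i) ∈ N := by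
      intro i hi
      by_cases hi2 : i = i₂
      · subst hi2
        have := hle i
        rw [if_neg hi, if_pos rfl] at this
        exact this (mem_span_singleton_self _)
      · have := hle i
        rw [if_neg hi, if_neg hi2] at this
        exact this (seg_mem_segTan (by omega) _)
    have hall : ∀ i, seg (p i) ∈ N := by
      intro i
      by_cases hi : i = i₁
      · subst hi
        refine (Submodule.smul_mem_iff _ h1).1 ?_
        have : γ i • seg (p i) = seg w - ∑ j ∈ Finset.univ.erase i, γ j • seg (p j) := by
          rw [hγ, ← Finset.add_sum_erase _ _ (Finset.mem_univ i)]; abel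
        rw [this]
        refine Submodule.sub_mem _ (hwN (seg_mem_segTan (by omega) _)) ?_
        exact Submodule.sum_mem _ fun j hj =>
          Submodule.smul_mem _ _ (hother j (Finset.ne_of_mem_erase hj))
      · exact hother i hi
    have hsp : segTan w ⊔ span K (Set.range fun i => seg (p i)) ≤ N := by
      refine sup_le hwN (span_le.2 ?_)
      rintro _ ⟨i, rfl⟩
      exact hall i
    have hM : ⨆ i, segTan (p i) ≤ N := by
      refine iSup_le fun i => ?_
      by_cases hi1 : i = i₁
      · subst hi1; exact (segTan_le_of_eq_sum hD hγ i h1).trans hsp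
      by_cases hi2 : i = i₂
      · subst hi2; exact (segTan_le_of_eq_sum hD hγ i h2).trans hsp
      have := hle i
      rwa [if_neg hi1, if_neg hi2] at this
    have h3 := Submodule.finrank_mono hM
    rw [hg.finrank_iSup hk (by omega)] at h3
    have h4 := finrank_iSup_le_sum fun i => if i = i₁ then segTan w else if i = i₂ then
      span K {seg (p i₂)} else segTan (p i)
    have h5 : ∑ i, finrank K ↥(if i = i₁ then segTan w else if i = i₂ then
      span K {seg (p i₂)} else segTan (p i)) < ∑ i : Fin k, (a * n + 1) := by
      refine Finset.sum_lt_sum (fun i _ => ?_) ⟨i₂, Finset.mem_univ _, ?_⟩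
      · by_cases hi1 : i = i₁
        · rw [if_pos hi1]
          exact finrank_segTan_le (by omega) w
        by_cases hi2 : i = i₂
        · rw [if_neg hi1, if_pos hi2]
          refine le_trans (b := 1) ?_ (by omega)
          simpa using finrank_span_le_card (R := K) {seg (p i₂)}
        · rw [if_neg hi1, if_neg hi2]
          exact finrank_segTan_le (by omega) (p i)
      · rw [if_neg hne.symm, if_pos rfl]
        refine lt_of_le_of_lt (b := 1) ?_ ?_
        · simpa using finrank_span_le_card (R := K) {seg (p i₂)}
        · have : 0 < a * n := Nat.mul_pos ha (by omega)
          omega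
    rw [Finset.sum_const, Finset.card_univ, Fintype.card_fin, smul_eq_mul] at h5
    exact absurd (h3.trans h4) (not_le.2 h5)
  · push Not at h0
    by_cases h1 : ∃ i, γ i ≠ 0
    · obtain ⟨i, hi⟩ := h1
      refine ⟨i, γ i, ?_⟩
      rw [hγ, Finset.sum_eq_single i]
      · intro j _ hj
        rw [h0 i j hj.symm hi, zero_smul]
      · simp
    · push Not at h1
      refine ⟨⟨0, hk⟩, 0, ?_⟩
      rw [hγ, zero_smul]
      exact Finset.sum_eq_zero fun i _ => by rw [h1, zero_smul]

end Core

section Generic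

open Module Submodule Function

/-- Coordinates on the space of configurations of `k` points and `e` extra vectors. -/
abbrev Par (n a k e : ℕ) : Type :=
  (Fin k × Σ _ : Fin n, Fin (a + 1)) ⊕ (Fin e × (Fin n → Fin (a + 1)))

variable {n a k e : ℕ}

/-- The points of the configuration with coordinates `x`. -/
def parP {K : Type*} (x : Par n a k e → K) (i : Fin k) (j : Fin n) (l : Fin (a + 1)) : K :=
  x (Sum.inl (i, ⟨j, l⟩))

/-- The extra vectors of the configuration with coordinates `x`. -/
def parC {K : Type*} (x : Par n a k e → K) (m : Fin e) (f : Fin n → Fin (a + 1)) : K :=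
  x (Sum.inr (m, f))

/-- Index set of the standard spanning family of a tangent span. -/
abbrev TanIdx (n a k e : ℕ) : Type := (Fin k × (Fin n × Fin (a + 1))) ⊕ Fin e

/-- The standard spanning family of a tangent span. -/
def tanFamily {K : Type*} [CommRing K] (p : Fin k → Fin n → Fin (a + 1) → K)
    (c : Fin e → (Fin n → Fin (a + 1)) → K) : TanIdx n a k e → (Fin n → Fin (a + 1)) → K :=
  Sum.elim (fun x => segPartial (p x.1) x.2) c

theorem map_tanFamily {K K' : Type*} [CommRing K] [CommRing K'] (φ : K →+* K')
    (p : Fin k → Fin n → Fin (a + 1) → K) (c : Fin e → (Fin n → Fin (a + 1)) → K)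
    (x : TanIdx n a k e) (f : Fin n → Fin (a + 1)) :
    φ (tanFamily p c x f) =
      tanFamily (fun i j l => φ (p i j l)) (fun m f => φ (c m f)) x f := by
  rcases x with x | m
  · exact map_segPartial φ _ _ _
  · rfl

theorem iSup_segTan_eq_span {K : Type*} [Field K] {ι : Type*} (p : ι → Fin n → Fin (a + 1) → K) :
    ⨆ i, segTan (p i) = span K (Set.range fun x : ι × (Fin n × Fin (a + 1)) =>
      segPartial (p x.1) x.2) := by
  simp only [segTan_eq_span]
  rw [← span_iUnion]
  congr 1
  ext x
  simp [Set.mem_iUnion]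

theorem tanSpan_eq_span {K : Type*} [Field K] (p : Fin k → Fin n → Fin (a + 1) → K)
    (c : Fin e → (Fin n → Fin (a + 1)) → K) :
    tanSpan p c = span K (Set.range (tanFamily p c)) := by
  rw [tanSpan, iSup_segTan_eq_span, tanFamily, Set.Sum.elim_range, span_union]

/-- If for each point and each factor some configuration attains the maximal rank, then the
general configuration is good. -/
theorem exists_polynomial_goodConfig
    (h : ∀ (i : Fin k) (j₀ : Fin n), ∃ (p : Fin k → Fin n → Fin (a + 1) → ℂ)
      (c : Fin e → (Fin n → Fin (a + 1)) → ℂ) (u : Fin (a + 1) → ℂ),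
      k * (a * n + 1) + e + a * (n - 1) ≤
        finrank ℂ ↥(tanSpan p c ⊔ segTan (update (p i) j₀ u))) :
    ∃ F : MvPolynomial (Par n a k e) ℂ, F ≠ 0 ∧
      ∀ (E : Type) [Field E] [Algebra ℂ E] (X : Par n a k e → E), MvPolynomial.aeval X F ≠ 0 →
        GoodConfig (parP X) (parC X) := by
  have key : ∀ (i : Fin k) (j₀ : Fin n), ∃ F : MvPolynomial (Par n a k e) ℂ, F ≠ 0 ∧
      ∀ (E : Type) [Field E] [Algebra ℂ E] (X : Par n a k e → E), MvPolynomial.aeval X F ≠ 0 →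
        ∃ u, k * (a * n + 1) + e + a * (n - 1) ≤
          finrank E ↥(tanSpan (parP X) (parC X) ⊔ segTan (update (parP X i) j₀ u)) := by
    intro i j₀
    obtain ⟨p, c, u, hr⟩ := h i j₀
    let M : (TanIdx n a k e ⊕ (Fin n × Fin (a + 1))) → (Fin n → Fin (a + 1)) →
        MvPolynomial (Par n a k e) ℂ :=
      Sum.elim (tanFamily (parP MvPolynomial.X) (parC MvPolynomial.X))
        (segPartial (update (parP MvPolynomial.X i) j₀ fun l => MvPolynomial.C (u l)))
    have hM : ∀ (E : Type) [Field E] [Algebra ℂ E] (X : Par n a k e → E),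
        span E (Set.range fun x f => MvPolynomial.aeval X (M x f)) =
          tanSpan (parP X) (parC X) ⊔ segTan (update (parP X i) j₀ fun l => algebraMap ℂ E (u l)) := by
      intro E _ _ X
      rw [tanSpan_eq_span, segTan_eq_span, ← span_union, ← Set.Sum.elim_range]
      congr 2
      funext x f
      rcases x with x | x
      · change (MvPolynomial.aeval X).toRingHom (tanFamily _ _ x f) = tanFamily _ _ x f
        rw [map_tanFamily]
        have h1 : (fun i j l => (MvPolynomial.aeval X).toRingHom
            (parP (MvPolynomial.X (R := ℂ)) i j l)) = parP X := by
          funext i j l; simp [parP]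
        have h2 : (fun m f => (MvPolynomial.aeval X).toRingHom
            (parC (MvPolynomial.X (R := ℂ)) m f)) = parC X := by
          funext m f; simp [parC]
        rw [h1, h2]
      · change (MvPolynomial.aeval X).toRingHom (segPartial _ x f) = segPartial _ x f
        rw [map_segPartial]
        refine congrArg (fun w => segPartial w x f) (funext fun j => funext fun l => ?_)
        by_cases hj : j = j₀
        · subst hj; simp
        · simp [hj, parP]
    let x₀ : Par n a k e → ℂ := Sum.elim (fun x => p x.1 x.2.1 x.2.2) fun y => c y.1 y.2
    obtain ⟨F, hF, hF'⟩ := exists_polynomial_le_finrank M x₀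
      (r := k * (a * n + 1) + e + a * (n - 1)) (by
        refine hr.trans (le_of_eq ?_)
        have h1 : span ℂ (Set.range fun x f => MvPolynomial.eval x₀ (M x f)) = _ := hM ℂ x₀
        rw [h1]
        rfl)
    refine ⟨F, fun h0 => hF (by rw [h0, map_zero]), fun E _ _ X hX =>
      ⟨fun l => algebraMap ℂ E (u l), ?_⟩⟩
    rw [← hM E X]
    exact hF' E X hX
  choose F hF0 hF using key
  refine ⟨(∏ x : Fin k × Fin n, F x.1 x.2) *
    ∏ x : Fin k × Fin n, MvPolynomial.X (Sum.inl (x.1, ⟨x.2, 0⟩)), ?_, ?_⟩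
  · exact mul_ne_zero (Finset.prod_ne_zero_iff.2 fun x _ => hF0 _ _)
      (Finset.prod_ne_zero_iff.2 fun x _ => MvPolynomial.X_ne_zero _)
  · intro E _ _ X hX
    rw [map_mul, map_prod, map_prod] at hX
    have h1 := Finset.prod_ne_zero_iff.1 (left_ne_zero_of_mul hX)
    have h2 := Finset.prod_ne_zero_iff.1 (right_ne_zero_of_mul hX)
    refine ⟨fun i j h0 => ?_, fun i j₀ => hF i j₀ E X (h1 (i, j₀) (Finset.mem_univ _))⟩
    apply h2 (i, j) (Finset.mem_univ _)
    rw [MvPolynomial.aeval_X]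
    exact congrFun h0 0

theorem hasFreeDirections_of_dual {E : Type} [Field E] [Algebra ℂ E] (X : Par n a k e → E)
    (D : Par n a k e → Derivation ℂ E E) (hD : ∀ s t, D s (X t) = if s = t then 1 else 0) :
    HasFreeDirections (parP X) (parC X) := by
  intro y g
  let z : Par n a k e → E := Sum.elim (fun x => y x.1 x.2.1 x.2.2) fun x => g x.1 x.2
  have key : ∀ t, (∑ s, z s • D s) (X t) = z t := by
    intro t
    rw [← Derivation.coeFnAddMonoidHom_apply, map_sum, Finset.sum_apply]
    simp [hD]
  exact ⟨∑ s, z s • D s, fun i j => funext fun l => key _, fun m => funext fun f => key _⟩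

/-- The expression whose vanishing, for some `ρ`, says that `s` and `t` are not proportional. -/
def minorEq {K κ : Type*} [CommRing K] [Fintype κ] (s t : κ → K) (ρ : κ × κ → K) : K :=
  ∑ x : κ × κ, ρ x * (s x.1 * t x.2 - s x.2 * t x.1) - 1

theorem minorEq_smul_ne_zero {K κ : Type*} [Field K] [Fintype κ] (t : κ → K) (b : K)
    (ρ : κ × κ → K) : minorEq (b • t) t ρ ≠ 0 := by
  have : minorEq (b • t) t ρ = -1 := by
    rw [minorEq, Finset.sum_eq_zero, zero_sub]
    intro x _
    simp only [Pi.smul_apply, smul_eq_mul]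
    ring
  rw [this]
  simp

theorem exists_minorEq_eq_zero {K κ : Type*} [Field K] [Fintype κ] {s t : κ → K} (ht : t ≠ 0)
    (h : ∀ b : K, s ≠ b • t) : ∃ ρ : κ × κ → K, minorEq s t ρ = 0 := by
  classical
  obtain ⟨g, hg⟩ := Function.ne_iff.1 ht
  obtain ⟨f, hf⟩ := Function.ne_iff.1 (h (s g / t g))
  have hne : s f * t g - s g * t f ≠ 0 := by
    intro h0
    apply hf
    rw [Pi.smul_apply, smul_eq_mul, div_mul_eq_mul_div, eq_div_iff hg]
    linear_combination h0
  refine ⟨Pi.single (f, g) (s f * t g - s g * t f)⁻¹, ?_⟩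
  rw [minorEq, Finset.sum_eq_single (f, g)]
  · rw [Pi.single_eq_same, inv_mul_cancel₀ hne, sub_self]
  · intro x _ hx
    rw [Pi.single_eq_of_ne hx, zero_mul]
  · simp

theorem map_minorEq {K K' κ : Type*} [CommRing K] [CommRing K'] [Fintype κ] (φ : K →+* K')
    (s t : κ → K) (ρ : κ × κ → K) :
    φ (minorEq s t ρ) = minorEq (fun f => φ (s f)) (fun f => φ (t f)) fun x => φ (ρ x) := by
  simp [minorEq]

theorem seg_ne_zero {K : Type*} [Field K] {v : Fin n → Fin (a + 1) → K} (hv : ∀ j, v j ≠ 0) :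
    seg v ≠ 0 := by
  choose f hf using fun j => Function.ne_iff.1 (hv j)
  intro h
  have := congrFun h f
  rw [seg_apply] at this
  exact Finset.prod_ne_zero_iff.2 (fun j _ => hf j) this

end Generic

section GenericSystems

open Module Submodule Function

/-- A natural family of polynomial systems is either unsolvable at the general point, or solvable
at a generic point over some field extension. -/
theorem exists_generic_solution_of_natural {σ τ ι : Type} [Finite σ] [Finite τ] [DecidableEq σ]
    (sys : ∀ (K : Type) [CommRing K], (σ → K) → (τ → K) → ι → K)
    (hsys : ∀ (K K' : Type) [CommRing K] [CommRing K'] (φ : K →+* K') x y i,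
      φ (sys K x y i) = sys K' (φ ∘ x) (φ ∘ y) i) :
    (∃ F : MvPolynomial σ ℂ, F ≠ 0 ∧ ∀ x, MvPolynomial.eval x F ≠ 0 → ∀ y, ∃ i, sys ℂ x y i ≠ 0) ∨
    ∃ (E : Type) (_ : Field E) (_ : Algebra ℂ E) (X : σ → E) (y : τ → E)
      (D : σ → Derivation ℂ E E), (∀ F : MvPolynomial σ ℂ, F ≠ 0 → MvPolynomial.aeval X F ≠ 0) ∧
      (∀ s t, D s (X t) = if s = t then 1 else 0) ∧ ∀ i, sys E X y i = 0 := by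
  let g : ι → MvPolynomial (σ ⊕ τ) ℂ := sys _ (fun s => MvPolynomial.X (Sum.inl s))
    fun t => MvPolynomial.X (Sum.inr t)
  have hg : ∀ (E : Type) [Field E] [Algebra ℂ E] (x : σ → E) (y : τ → E) i,
      MvPolynomial.aeval (Sum.elim x y) (g i) = sys E x y i := by
    intro E _ _ x y i
    change (MvPolynomial.aeval (Sum.elim x y)).toRingHom (sys _ _ _ i) = _
    rw [hsys]
    congr 1 <;> · funext s; simp
  rcases exists_generic_solution (Set.range g) with ⟨F, hF, h⟩ | ⟨E, i1, i2, X, y, D, h1, h2, h3⟩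
  · refine Or.inl ⟨F, hF, fun x hx y => ?_⟩
    obtain ⟨_, ⟨i, rfl⟩, hi⟩ := h x hx y
    refine ⟨i, ?_⟩
    rw [← hg ℂ x y i]
    exact hi
  · refine Or.inr ⟨E, i1, i2, X, y, D, h1, h2, fun i => ?_⟩
    rw [← hg E X y i]
    exact h3 _ ⟨i, rfl⟩

variable {n a k e : ℕ}

theorem eq_smul_or_exists_minorEq {K ι κ : Type*} [Field K] [Fintype κ] (s : κ → K) (t : ι → κ → K)
    (ht : ∀ i, t i ≠ 0) (h : ∀ i (b : K), s ≠ b • t i) :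
    ∃ ρ : ι → κ × κ → K, ∀ i, minorEq s (t i) (ρ i) = 0 :=
  ⟨fun i => (exists_minorEq_eq_zero (ht i) (h i)).choose,
    fun i => (exists_minorEq_eq_zero (ht i) (h i)).choose_spec⟩

/-- Equations expressing that the tangent space at `w` lies in a tangent span, while `w` is not
proportional to any of the given points. -/
def tangencySystem (K : Type) [CommRing K] (x : Par n a k e → K)
    (y : (Fin n × Fin (a + 1)) ⊕ ((Fin n × Fin (a + 1)) × TanIdx n a k e) ⊕
      (Fin k × ((Fin n → Fin (a + 1)) × (Fin n → Fin (a + 1)))) → K) :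
    ((Fin n × Fin (a + 1)) × (Fin n → Fin (a + 1))) ⊕ Fin k → K :=
  Sum.elim
    (fun z => segPartial (fun j l => y (Sum.inl (j, l))) z.1 z.2 -
      ∑ t, y (Sum.inr (Sum.inl (z.1, t))) * tanFamily (parP x) (parC x) t z.2)
    fun i => minorEq (seg fun j l => y (Sum.inl (j, l))) (seg (parP x i))
      fun z => y (Sum.inr (Sum.inr (i, z)))

theorem map_tangencySystem (K K' : Type) [CommRing K] [CommRing K'] (φ : K →+* K')
    (x : Par n a k e → K) (y i) :
    φ (tangencySystem K x y i) = tangencySystem K' (φ ∘ x) (φ ∘ y) i := by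
  rcases i with z | i
  · simp only [tangencySystem, Sum.elim_inl, map_sub, map_sum, map_mul, map_segPartial,
      map_tanFamily]
    rfl
  · simp only [tangencySystem, Sum.elim_inr, map_minorEq, map_seg]
    rfl

/-- The general tangent span is tangent to the Segre cone only along the given points. -/
theorem exists_polynomial_tangent_only (hk : 0 < k) (hn : 1 < n) (ha : 0 < a)
    (h : ∀ (i : Fin k) (j₀ : Fin n), ∃ (p : Fin k → Fin n → Fin (a + 1) → ℂ)
      (c : Fin e → (Fin n → Fin (a + 1)) → ℂ) (u : Fin (a + 1) → ℂ),
      k * (a * n + 1) + e + a * (n - 1) ≤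
        finrank ℂ ↥(tanSpan p c ⊔ segTan (update (p i) j₀ u))) :
    ∃ F : MvPolynomial (Par n a k e) ℂ, F ≠ 0 ∧ ∀ x, MvPolynomial.eval x F ≠ 0 →
      GoodConfig (parP x) (parC x) ∧ ∀ w, segTan w ≤ tanSpan (parP x) (parC x) →
        ∃ (i : Fin k) (t : ℂ), seg w = t • seg (parP x i) := by
  classical
  obtain ⟨G, hG0, hG⟩ := exists_polynomial_goodConfig h
  rcases exists_generic_solution_of_natural (tangencySystem (n := n) (a := a) (k := k) (e := e))
    (map_tangencySystem (n := n) (a := a) (k := k) (e := e)) with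
    ⟨F, hF0, hF⟩ | ⟨E, i1, i2, X, y, D, h1, h2, h3⟩
  · refine ⟨F * G, mul_ne_zero hF0 hG0, fun x hx => ?_⟩
    rw [map_mul] at hx
    have hgood := hG ℂ x (right_ne_zero_of_mul hx)
    refine ⟨hgood, fun w hw => ?_⟩
    by_contra! hne
    obtain ⟨ρ, hρ⟩ := eq_smul_or_exists_minorEq (seg w) (fun i => seg (parP x i))
      (fun i => seg_ne_zero (hgood.ne_zero i)) hne
    have hc : ∀ z, ∃ c : TanIdx n a k e → ℂ,
        ∑ t, c t • tanFamily (parP x) (parC x) t = segPartial w z := by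
      intro z
      rw [← mem_span_range_iff_exists_fun, ← tanSpan_eq_span]
      exact hw (seg_update_mem_segTan _ _ _)
    choose c hc using hc
    obtain ⟨i, hi⟩ := hF x (left_ne_zero_of_mul hx) (Sum.elim (fun z => w z.1 z.2)
      (Sum.elim (fun z => c z.1 z.2) fun z => ρ z.1 z.2))
    apply hi
    rcases i with z | i
    · have := congrFun (hc z.1) z.2
      simp only [Finset.sum_apply, Pi.smul_apply, smul_eq_mul] at this
      simp only [tangencySystem, Sum.elim_inl, Sum.elim_inr]
      rw [this, sub_self]
    · exact hρ i
  · exfalso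
    set w : Fin n → Fin (a + 1) → E := fun j l => y (Sum.inl (j, l)) with hw
    have hle : segTan w ≤ tanSpan (parP X) (parC X) := by
      rw [segTan_eq_span, span_le]
      rintro _ ⟨z, rfl⟩
      rw [SetLike.mem_coe, tanSpan_eq_span, mem_span_range_iff_exists_fun]
      refine ⟨fun t => y (Sum.inr (Sum.inl (z, t))), funext fun f => ?_⟩
      have := h3 (Sum.inl (z, f))
      simp only [tangencySystem, Sum.elim_inl] at this
      simp only [Finset.sum_apply, Pi.smul_apply, smul_eq_mul]
      exact (sub_eq_zero.1 this).symm
    obtain ⟨i, t, hit⟩ := (hG E X (h1 G hG0)).exists_eq_smul_seg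
      (hasFreeDirections_of_dual X D h2) hk hn ha hle
    have h4 := h3 (Sum.inr i)
    simp only [tangencySystem, Sum.elim_inr] at h4
    rw [← hw, hit] at h4
    exact minorEq_smul_ne_zero _ _ _ h4

/-- Equations expressing that `y` is a decomposition of the sum of the points of `x` whose summand
at `i₀` is not proportional to any of these points. -/
def decompositionSystem (i₀ : Fin k) (K : Type) [CommRing K] (x : Par n a k e → K)
    (y : (Fin k × Fin n × Fin (a + 1)) ⊕
      (Fin k × ((Fin n → Fin (a + 1)) × (Fin n → Fin (a + 1)))) → K) :
    (Fin n → Fin (a + 1)) ⊕ Fin k → K :=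
  Sum.elim
    (fun f => ∑ i, seg (fun j l => y (Sum.inl (i, j, l))) f - ∑ i, seg (parP x i) f)
    fun i => minorEq (seg fun j l => y (Sum.inl (i₀, j, l))) (seg (parP x i))
      fun z => y (Sum.inr (i, z))

theorem map_decompositionSystem (i₀ : Fin k) (K K' : Type) [CommRing K] [CommRing K']
    (φ : K →+* K') (x : Par n a k e → K) (y i) :
    φ (decompositionSystem i₀ K x y i) = decompositionSystem i₀ K' (φ ∘ x) (φ ∘ y) i := by
  rcases i with z | i
  · simp only [decompositionSystem, Sum.elim_inl, map_sub, map_sum, map_seg]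
    rfl
  · simp only [decompositionSystem, Sum.elim_inr, map_minorEq, map_seg]
    rfl

/-- Over a field with enough derivations, two decompositions have the same tangent span. -/
theorem iSup_segTan_le_of_sum_eq {E : Type} [Field E] [Algebra ℂ E]
    {p s : Fin k → Fin n → Fin (a + 1) → E} {c : Fin e → (Fin n → Fin (a + 1)) → E}
    (hD : HasFreeDirections p c) (h : ∑ i, seg (s i) = ∑ i, seg (p i)) :
    ⨆ i, segTan (p i) ≤ ⨆ i, segTan (s i) := by
  refine iSup_le fun i₀ => ?_
  rintro _ ⟨y, rfl⟩
  obtain ⟨D, hDp, -⟩ := hD (Pi.single i₀ y) 0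
  have h1 : D ∘ (∑ i, seg (s i)) ∈ ⨆ i, segTan (s i) := by
    rw [derivation_comp_sum]
    refine Submodule.sum_mem _ fun i _ => mem_iSup_of_mem i ?_
    rw [derivation_comp_seg]
    exact linearDeriv_seg_mem _ _
  rw [h, derivation_comp_sum, Finset.sum_eq_single i₀] at h1
  · rw [derivation_comp_seg] at h1
    simpa only [hDp, Pi.single_eq_same] using h1
  · intro i _ hi
    rw [derivation_comp_seg]
    simp only [hDp, Pi.single_eq_of_ne hi]
    exact map_zero _
  · simp

/-- The summands of every decomposition of the general sum are proportional to the given ones. -/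
theorem exists_polynomial_decomposition (hk : 0 < k) (hn : 1 < n) (ha : 0 < a)
    (h : ∀ (i : Fin k) (j₀ : Fin n), ∃ (p : Fin k → Fin n → Fin (a + 1) → ℂ)
      (c : Fin e → (Fin n → Fin (a + 1)) → ℂ) (u : Fin (a + 1) → ℂ),
      k * (a * n + 1) + e + a * (n - 1) ≤
        finrank ℂ ↥(tanSpan p c ⊔ segTan (update (p i) j₀ u))) :
    ∃ F : MvPolynomial (Par n a k e) ℂ, F ≠ 0 ∧ ∀ x, MvPolynomial.eval x F ≠ 0 →
      GoodConfig (parP x) (parC x) ∧ ∀ s : Fin k → Fin n → Fin (a + 1) → ℂ,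
        ∑ i, seg (s i) = ∑ i, seg (parP x i) →
        ∀ i₀, ∃ (i : Fin k) (t : ℂ), seg (s i₀) = t • seg (parP x i) := by
  classical
  obtain ⟨G, hG0, hG⟩ := exists_polynomial_goodConfig h
  have key : ∀ i₀ : Fin k, ∃ F : MvPolynomial (Par n a k e) ℂ, F ≠ 0 ∧
      ∀ x, MvPolynomial.eval x F ≠ 0 → GoodConfig (parP x) (parC x) →
      ∀ s : Fin k → Fin n → Fin (a + 1) → ℂ, ∑ i, seg (s i) = ∑ i, seg (parP x i) →
        ∃ (i : Fin k) (t : ℂ), seg (s i₀) = t • seg (parP x i) := by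
    intro i₀
    rcases exists_generic_solution_of_natural
      (decompositionSystem (n := n) (a := a) (k := k) (e := e) i₀)
      (map_decompositionSystem (n := n) (a := a) (k := k) (e := e) i₀) with
      ⟨F, hF0, hF⟩ | ⟨E, i1, i2, X, y, D, h1, h2, h3⟩
    · refine ⟨F, hF0, fun x hx hgood s hs => ?_⟩
      by_contra! hne
      obtain ⟨ρ, hρ⟩ := eq_smul_or_exists_minorEq (seg (s i₀)) (fun i => seg (parP x i))
        (fun i => seg_ne_zero (hgood.ne_zero i)) hne
      obtain ⟨i, hi⟩ := hF x hx (Sum.elim (fun z => s z.1 z.2.1 z.2.2) fun z => ρ z.1 z.2)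
      apply hi
      rcases i with f | i
      · have := congrFun hs f
        simp only [Finset.sum_apply] at this
        exact sub_eq_zero.2 this
      · exact hρ i
    · exfalso
      set s : Fin k → Fin n → Fin (a + 1) → E := fun i j l => y (Sum.inl (i, j, l)) with hs
      have hgood := hG E X (h1 G hG0)
      have hfree := hasFreeDirections_of_dual X D h2
      have hsum : ∑ i, seg (s i) = ∑ i, seg (parP X i) := by
        funext f
        simp only [Finset.sum_apply]
        exact sub_eq_zero.1 (h3 (Sum.inl f))
      have hle := iSup_segTan_le_of_sum_eq hfree hsum
      have heq := Submodule.eq_of_le_of_finrank_le hle (by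
        rw [hgood.finrank_iSup hk (by omega)]
        exact finrank_iSup_segTan_le (by omega) s)
      have hle' : segTan (s i₀) ≤ tanSpan (parP X) (parC X) := by
        refine le_trans ?_ le_sup_left
        rw [heq]
        exact le_iSup (fun i => segTan (s i)) i₀
      obtain ⟨i, t, hit⟩ := hgood.exists_eq_smul_seg hfree hk hn ha hle'
      have h4 := h3 (Sum.inr i)
      simp only [decompositionSystem, Sum.elim_inr] at h4
      change minorEq (seg (s i₀)) _ _ = 0 at h4
      rw [hit] at h4
      exact minorEq_smul_ne_zero _ _ _ h4
  choose F hF0 hF using key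
  refine ⟨(∏ i, F i) * G, mul_ne_zero (Finset.prod_ne_zero_iff.2 fun i _ => hF0 i) hG0,
    fun x hx => ?_⟩
  rw [map_mul, map_prod] at hx
  have hgood := hG ℂ x (right_ne_zero_of_mul hx)
  exact ⟨hgood, fun s hs i₀ => hF i₀ x
    (Finset.prod_ne_zero_iff.1 (left_ne_zero_of_mul hx) i₀ (Finset.mem_univ _)) hgood s hs⟩

/-- A sum of nonzero multiples of linearly independent vectors determines the summands. -/
theorem multiset_eq_of_sum_eq {K V ι : Type*} [Field K] [AddCommGroup V] [Module K V] [Fintype ι]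
    {v s : ι → V} (hv : LinearIndependent K v) (h : ∀ i, ∃ j, ∃ t : K, s i = t • v j)
    (hsum : ∑ i, s i = ∑ i, v i) : Finset.univ.val.map s = Finset.univ.val.map v := by
  classical
  choose σ t hst using h
  have h1 : ∑ j, (∑ i with σ i = j, t i) • v j = ∑ j, (1 : K) • v j := by
    simp only [one_smul, Finset.sum_smul]
    rw [← hsum]
    simp only [Finset.sum_filter]
    rw [Finset.sum_comm]
    refine Finset.sum_congr rfl fun i _ => ?_
    rw [hst, Finset.sum_ite_eq]
    simp
  have h2 : ∀ j, ∑ i with σ i = j, t i = 1 := fun j =>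
    sub_eq_zero.1 (Fintype.linearIndependent_iff.1 hv (fun j => ∑ i with σ i = j, t i - 1) (by
      simp only [sub_smul, Finset.sum_sub_distrib, h1, sub_self]) j)
  have hsurj : Function.Surjective σ := by
    intro j
    by_contra! hne
    have := h2 j
    rw [Finset.sum_eq_zero] at this
    · exact zero_ne_one this
    · intro i hi
      exact absurd (Finset.mem_filter.1 hi).2 (hne i)
  have hbij := Finite.injective_iff_bijective.1 (Finite.injective_iff_surjective.2 hsurj)
  have hs : s = v ∘ Equiv.ofBijective σ hbij := by
    funext i
    have h3 := h2 (σ i)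
    rw [Finset.sum_eq_single i] at h3
    · rw [hst, h3, one_smul]; rfl
    · intro i' hi' hne
      exact absurd (hbij.1 (Finset.mem_filter.1 hi').2) hne
    · simp
  rw [hs, ← Multiset.map_map, Multiset.map_univ_val_equiv]

end GenericSystems

section Transfer

open Module Submodule Function

variable {n a k : ℕ}

/-- Coordinates of a tensor in the standard basis. -/
def tenEquiv (n a : ℕ) : Ten n (fun _ => a) ≃ₗ[ℂ] ((Fin n → Fin (a + 1)) → ℂ) :=
  (Basis.piTensorProduct fun _ : Fin n => Pi.basisFun ℂ (Fin (a + 1))).equivFun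

theorem tenEquiv_tprod (v : Fin n → Fin (a + 1) → ℂ) : tenEquiv n a (tprod ℂ v) = seg v := by
  funext f
  rw [tenEquiv, Basis.equivFun_apply, Basis.piTensorProduct_repr_tprod_apply, seg_apply]
  simp

theorem tenEquiv_fromCoords (c : (Fin n → Fin (a + 1)) → ℂ) :
    tenEquiv n a (fromCoords (fun _ => a) c) = c := by
  have h : ∀ f, basisVec (fun _ : Fin n => a) f =
      Basis.piTensorProduct (fun _ : Fin n => Pi.basisFun ℂ (Fin (a + 1))) f := by
    intro f
    rw [Basis.piTensorProduct_apply, basisVec]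
    simp
  rw [fromCoords, tenEquiv, Finset.sum_congr rfl fun f _ => by rw [h f],
    ← Basis.equivFun_symm_apply, LinearEquiv.apply_symm_apply]

theorem map_tangent (v : Fin n → Fin (a + 1) → ℂ) :
    (tangent (fun _ => a) v).map (tenEquiv n a).toLinearMap = segTan v := by
  apply le_antisymm
  · rw [tangent, map_span_le]
    rintro _ ⟨j, u, rfl⟩
    rw [LinearEquiv.coe_coe, tenEquiv_tprod]
    exact seg_update_mem_segTan _ _ _
  · rw [segTan_le_iff]
    intro j u
    exact ⟨_, subset_span ⟨j, u, rfl⟩, tenEquiv_tprod _⟩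

theorem map_tangent_span {e : ℕ} (p : Fin k → Fin n → Fin (a + 1) → ℂ)
    (c : Fin e → (Fin n → Fin (a + 1)) → ℂ) :
    ((⨆ i, tangent (fun _ => a) (p i)) ⊔
      span ℂ (Set.range fun m => fromCoords (fun _ => a) (c m))).map (tenEquiv n a).toLinearMap =
      tanSpan p c := by
  rw [Submodule.map_sup, Submodule.map_iSup, map_span, ← Set.range_comp, tanSpan]
  congr 2
  · simp only [map_tangent]
  · congr 1
    funext m
    exact tenEquiv_fromCoords _

/-- Configurations of maximal rank give tangential generality. -/
theorem tangentGeneral_of_witness (hk : 0 < k) (hn : 1 < n) (ha : 0 < a) {d e : ℕ}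
    (he : d - k * (1 + ∑ _ : Fin n, a) = e) (hd : d = k * (a * n + 1) + e)
    (h : ∀ (i : Fin k) (j₀ : Fin n), ∃ (p : Fin k → Fin n → Fin (a + 1) → ℂ)
      (c : Fin e → (Fin n → Fin (a + 1)) → ℂ) (u : Fin (a + 1) → ℂ),
      k * (a * n + 1) + e + a * (n - 1) ≤
        finrank ℂ ↥(tanSpan p c ⊔ segTan (update (p i) j₀ u))) :
    TangentGeneral n (fun _ => a) k d := by
  subst he
  obtain ⟨F, hF0, hF⟩ := exists_polynomial_tangent_only hk hn ha h
  refine ⟨F, ?_, fun p c hpc => ?_⟩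
  · by_contra! h0
    refine hF0 (MvPolynomial.funext fun x => ?_)
    rw [map_zero, ← h0 (parP x) (parC x), evalWV]
    congr 2
    funext y
    rcases y with y | y <;> rfl
  · obtain ⟨h1, h2⟩ := hF _ hpc
    change GoodConfig p c at h1
    change ∀ w, segTan w ≤ tanSpan p c → ∃ i t, seg w = t • seg (p i) at h2
    refine ⟨?_, fun w _ hw => ?_⟩
    · rw [← LinearEquiv.finrank_map_eq (tenEquiv n a), map_tangent_span,
        h1.finrank_tanSpan hk (by omega)]
      exact hd.symm
    · have := Submodule.map_mono (f := (tenEquiv n a).toLinearMap) hw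
      rw [map_tangent, map_tangent_span] at this
      obtain ⟨i, t, hit⟩ := h2 w this
      refine ⟨i, t, (tenEquiv n a).injective ?_⟩
      rw [map_smul, tenEquiv_tprod, tenEquiv_tprod, hit]

/-- Configurations of maximal rank give identifiability. -/
theorem identifiable_of_witness (hk : 0 < k) (hn : 1 < n) (ha : 0 < a)
    (h : ∀ (i : Fin k) (j₀ : Fin n), ∃ (p : Fin k → Fin n → Fin (a + 1) → ℂ)
      (c : Fin 0 → (Fin n → Fin (a + 1)) → ℂ) (u : Fin (a + 1) → ℂ),
      k * (a * n + 1) + 0 + a * (n - 1) ≤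
        finrank ℂ ↥(tanSpan p c ⊔ segTan (update (p i) j₀ u))) :
    Identifiable n (fun _ => a) k := by
  obtain ⟨F, hF0, hF⟩ := exists_polynomial_decomposition hk hn ha h
  let ext (p : Fin k → Fin n → Fin (a + 1) → ℂ) : Par n a k 0 → ℂ :=
    Sum.elim (fun x => p x.1 x.2.1 x.2.2) fun y => y.1.elim0
  let F' : MvPolynomial (WIdx n (fun _ => a) k) ℂ := MvPolynomial.rename (Equiv.sumEmpty _ _) F
  have hF' : ∀ p, evalW F' p = MvPolynomial.eval (ext p) F := by
    intro p
    rw [evalW, MvPolynomial.eval_rename]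
    congr 2
    funext y
    rcases y with y | y
    · rfl
    · exact y.1.elim0
  refine ⟨F', ?_, fun p hp => ?_⟩
  · by_contra! h0
    refine hF0 (MvPolynomial.funext fun x => ?_)
    rw [map_zero, ← h0 (parP x), hF']
    congr 2
    funext y
    rcases y with y | y
    · rfl
    · exact y.1.elim0
  · rw [hF'] at hp
    obtain ⟨h1, h2⟩ := hF _ hp
    change GoodConfig p _ at h1
    change ∀ s : Fin k → _, ∑ i, seg (s i) = ∑ i, seg (p i) →
      ∀ i₀, ∃ i t, seg (s i₀) = t • seg (p i) at h2
    have huniq : ∀ s : Fin k → Ten n fun _ => a, (∀ i, IsDecomposable (s i)) →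
        ∑ i, s i = Phi (fun _ => a) p →
        Finset.univ.val.map s = Finset.univ.val.map fun i => tprod ℂ (p i) := by
      intro s hs hsum
      choose v _ hv using hs
      apply Multiset.map_injective (tenEquiv n a).injective
      rw [Multiset.map_map, Multiset.map_map]
      have hs1 : (tenEquiv n a) ∘ s = fun i => seg (v i) := by
        funext i
        rw [comp_apply, hv, tenEquiv_tprod]
      have hs2 : ((tenEquiv n a) ∘ fun i => tprod ℂ (p i)) = fun i => seg (p i) := by
        funext i
        rw [comp_apply, tenEquiv_tprod]
      have hsum' : ∑ i, seg (v i) = ∑ i, seg (p i) := by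
        have := congrArg (tenEquiv n a) hsum
        rw [Phi, map_sum, map_sum] at this
        simpa only [hv, tenEquiv_tprod] using this
      rw [hs1, hs2]
      exact multiset_eq_of_sum_eq (h1.linearIndependent_seg hk (by omega)) (h2 v hsum') hsum'
    refine ⟨⟨fun i => tprod ℂ (p i), fun i => ⟨p i, h1.ne_zero i, rfl⟩, rfl⟩, ?_⟩
    intro s t hs ht hs' ht'
    rw [huniq s hs hs', huniq t ht ht']

end Transfer

section Slices

open Module Submodule Function

variable {n a k : ℕ}

/-- Submodules cut out by complementary projections are independent. -/
theorem sum_finrank_le_of_projections {K V ι : Type*} [Field K] [AddCommGroup V] [Module K V]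
    [FiniteDimensional K V] [Fintype ι] (W : ι → Submodule K V) (M : Submodule K V)
    (hM : ∀ β, W β ≤ M) (π : ι → V →ₗ[K] V) (h : ∀ β, ∀ w ∈ W β, π β w = w)
    (h' : ∀ β β', β ≠ β' → ∀ w ∈ W β', π β w = 0) : ∑ β, finrank K (W β) ≤ finrank K M := by
  classical
  let f : (∀ β, W β) →ₗ[K] V := LinearMap.lsum K (fun β => W β) K fun β => (W β).subtype
  have hf : ∀ w, f w = ∑ β, (w β : V) := by
    intro w
    simp [f, LinearMap.lsum_apply]
  have hinj : Injective f := by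
    refine (injective_iff_map_eq_zero f).2 fun w hw => funext fun β => Subtype.ext ?_
    have h1 := congrArg (π β) hw
    rw [hf, map_sum, map_zero, Finset.sum_eq_single β] at h1
    · rw [h β _ (w β).2] at h1; exact h1
    · intro β' _ hne
      exact h' β β' hne.symm _ (w β').2
    · simp
  have hle : LinearMap.range f ≤ M := by
    rintro _ ⟨w, rfl⟩
    rw [hf]
    exact Submodule.sum_mem _ fun β _ => hM β (w β).2
  have h1 := Submodule.finrank_mono hle
  rwa [LinearMap.finrank_range_of_inj hinj, finrank_pi_fintype] at h1

/-- Tensoring with `z` in the position `j₀`. -/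
def tz {K : Type*} [CommRing K] (j₀ : Fin (n + 1)) (z : Fin (a + 1) → K) :
    ((Fin n → Fin (a + 1)) → K) →ₗ[K] ((Fin (n + 1) → Fin (a + 1)) → K) where
  toFun y f := z (f j₀) * y (j₀.removeNth f)
  map_add' y y' := funext fun f => mul_add _ _ _
  map_smul' b y := funext fun f => by
    simp only [Pi.smul_apply, smul_eq_mul, RingHom.id_apply]; ring

section tz

variable {K : Type*} [CommRing K] (j₀ : Fin (n + 1))

theorem tz_apply (z : Fin (a + 1) → K) (y f) : tz j₀ z y f = z (f j₀) * y (j₀.removeNth f) := rfl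

theorem map_tz {K' : Type*} [CommRing K'] (φ : K →+* K') (z : Fin (a + 1) → K)
    (y : (Fin n → Fin (a + 1)) → K) (f) :
    φ (tz j₀ z y f) = tz j₀ (fun l => φ (z l)) (fun g => φ (y g)) f := by
  simp [tz_apply]

theorem tz_add (z z' : Fin (a + 1) → K) (y : (Fin n → Fin (a + 1)) → K) :
    tz j₀ (z + z') y = tz j₀ z y + tz j₀ z' y :=
  funext fun f => by simp only [tz_apply, Pi.add_apply]; ring

theorem tz_smul (b : K) (z : Fin (a + 1) → K) (y : (Fin n → Fin (a + 1)) → K) :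
    tz j₀ (b • z) y = b • tz j₀ z y :=
  funext fun f => by simp only [tz_apply, Pi.smul_apply, smul_eq_mul]; ring

theorem tz_zero (y : (Fin n → Fin (a + 1)) → K) : tz j₀ 0 y = 0 :=
  funext fun f => by simp [tz_apply]

theorem seg_insertNth (z : Fin (a + 1) → K) (x : Fin n → Fin (a + 1) → K) :
    seg (j₀.insertNth (α := fun _ => Fin (a + 1) → K) z x) = tz j₀ z (seg x) := by
  funext f
  rw [seg_apply, Fin.prod_univ_succAbove _ j₀, tz_apply, seg_apply]
  simp [Fin.removeNth]

end tz

variable {K : Type*} [Field K] (j₀ : Fin (n + 1))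

theorem tz_seg_mem_segTan (z z' : Fin (a + 1) → K) (x : Fin n → Fin (a + 1) → K) :
    tz j₀ z' (seg x) ∈ segTan (j₀.insertNth (α := fun _ => Fin (a + 1) → K) z x) := by
  have h := Fin.update_insertNth (α := fun _ => Fin (a + 1) → K) j₀ z z' x
  rw [← seg_insertNth, ← h]
  exact seg_update_mem_segTan _ _ _

theorem tz_mem_segTan (z : Fin (a + 1) → K) (x : Fin n → Fin (a + 1) → K)
    {y : (Fin n → Fin (a + 1)) → K} (hy : y ∈ segTan x) :
    tz j₀ z y ∈ segTan (j₀.insertNth (α := fun _ => Fin (a + 1) → K) z x) := by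
  suffices h : segTan x ≤ (segTan (j₀.insertNth (α := fun _ => Fin (a + 1) → K) z x)).comap
    (tz j₀ z) from h hy
  rw [segTan_le_iff]
  intro j u
  rw [mem_comap, ← seg_insertNth, Fin.insertNth_update]
  exact seg_update_mem_segTan _ _ _

/-- The part of a sum of tangent spaces lying in a block of slices: `z i` is the vector of the
block attached to the point `i` (zero when there is none), `E` the standard vectors of the block. -/
def blockFamily {K : Type*} [CommRing K] (j₀ : Fin (n + 1)) (z : Fin k → Fin (a + 1) → K)
    (E : Fin (a + 1) → Fin (a + 1) → K) (x : Fin k → Fin n → Fin (a + 1) → K) :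
    (Fin k × (Fin n × Fin (a + 1))) ⊕ (Fin k × Fin (a + 1)) → (Fin (n + 1) → Fin (a + 1)) → K :=
  Sum.elim (fun t => tz j₀ (z t.1) (segPartial (x t.1) t.2)) fun t => tz j₀ (E t.2) (seg (x t.1))

theorem map_blockFamily {K K' : Type*} [CommRing K] [CommRing K'] (φ : K →+* K')
    (z : Fin k → Fin (a + 1) → K) (E : Fin (a + 1) → Fin (a + 1) → K)
    (x : Fin k → Fin n → Fin (a + 1) → K) (t f) :
    φ (blockFamily j₀ z E x t f) = blockFamily j₀ (fun i l => φ (z i l)) (fun c l => φ (E c l))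
      (fun i j l => φ (x i j l)) t f := by
  rcases t with t | t
  · simp only [blockFamily, Sum.elim_inl, map_tz, map_segPartial]
  · simp only [blockFamily, Sum.elim_inr, map_tz, map_seg]

/-- The standard vectors of the block `β`. -/
def blockVec {ι : Type*} [DecidableEq ι] (blk : Fin (a + 1) → ι) (β : ι) (c : Fin (a + 1)) :
    Fin (a + 1) → ℂ := if blk c = β then Pi.single c 1 else 0

/-- Configurations attaining prescribed ranks in each block can be chosen simultaneously, and the
ranks add up. -/
theorem exists_sum_le_finrank {ι : Type} [Fintype ι] [DecidableEq ι] (blk : Fin (a + 1) → ι)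
    (z : ι → Fin k → Fin (a + 1) → ℂ) (hz : ∀ β i c, blk c ≠ β → z β i c = 0) (R : ι → ℕ)
    (hR : ∀ β, ∃ x, R β ≤
      finrank ℂ ↥(span ℂ (Set.range (blockFamily (n := n) j₀ (z β) (blockVec blk β) x)))) :
    ∃ x : Fin k → Fin n → Fin (a + 1) → ℂ,
      ∀ M : Submodule ℂ ((Fin (n + 1) → Fin (a + 1)) → ℂ),
        (∀ i, ∃ v, segTan (j₀.insertNth (α := fun _ => Fin (a + 1) → ℂ) v (x i)) ≤ M) →
        (∀ β i, z β i ≠ 0 →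
          segTan (j₀.insertNth (α := fun _ => Fin (a + 1) → ℂ) (z β i) (x i)) ≤ M) →
        ∑ β, R β ≤ finrank ℂ M := by
  let X : Fin k → Fin n → Fin (a + 1) → MvPolynomial (Fin k × Fin n × Fin (a + 1)) ℂ :=
    fun i j l => MvPolynomial.X (i, j, l)
  let P (β : ι) := blockFamily j₀ (fun i l => MvPolynomial.C (z β i l))
    (fun c l => MvPolynomial.C (blockVec blk β c l)) X
  have hP : ∀ β (x : Fin k × Fin n × Fin (a + 1) → ℂ), (fun t f => MvPolynomial.eval x (P β t f)) =
      blockFamily j₀ (z β) (blockVec blk β) fun i j l => x (i, j, l) := by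
    intro β x
    funext t f
    rw [map_blockFamily]
    simp [X]
  have hF : ∀ β, ∃ F : MvPolynomial (Fin k × Fin n × Fin (a + 1)) ℂ, F ≠ 0 ∧
      ∀ x, MvPolynomial.eval x F ≠ 0 → R β ≤ finrank ℂ ↥(span ℂ (Set.range
        (blockFamily j₀ (z β) (blockVec blk β) fun i j l => x (i, j, l)))) := by
    intro β
    obtain ⟨x, hx⟩ := hR β
    obtain ⟨F, hF, hF'⟩ := exists_polynomial_le_finrank (P β) (fun t => x t.1 t.2.1 t.2.2)
      (r := R β) (by rw [hP]; exact hx)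
    refine ⟨F, fun h0 => hF (by rw [h0, map_zero]), fun x hx => ?_⟩
    rw [← hP]
    exact hF' ℂ x hx
  choose F hF0 hF using hF
  obtain ⟨x, hx⟩ : ∃ x, MvPolynomial.eval x (∏ β, F β) ≠ 0 := by
    by_contra! h0
    refine (Finset.prod_ne_zero_iff.2 fun β (_ : β ∈ Finset.univ) => hF0 β)
      (MvPolynomial.funext fun x => ?_)
    rw [h0, map_zero]
  rw [map_prod] at hx
  refine ⟨fun i j l => x (i, j, l), fun M hM1 hM2 => ?_⟩
  refine (Finset.sum_le_sum fun β _ => hF β x (Finset.prod_ne_zero_iff.1 hx β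
    (Finset.mem_univ _))).trans ?_
  let π (β : ι) : ((Fin (n + 1) → Fin (a + 1)) → ℂ) →ₗ[ℂ] ((Fin (n + 1) → Fin (a + 1)) → ℂ) :=
    LinearMap.pi fun f => if blk (f j₀) = β then LinearMap.proj f else 0
  have hπ : ∀ β w f, π β w f = if blk (f j₀) = β then w f else 0 := by
    intro β w f
    simp only [π, LinearMap.pi_apply]
    split_ifs <;> rfl
  have hsupp : ∀ β, ∀ w ∈ span ℂ (Set.range (blockFamily j₀ (z β) (blockVec blk β)
      fun i j l => x (i, j, l))), ∀ f, blk (f j₀) ≠ β → w f = 0 := by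
    intro β w hw
    induction hw using span_induction with
    | mem w hw =>
      obtain ⟨t, rfl⟩ := hw
      intro f hf
      rcases t with t | t
      · simp only [blockFamily, Sum.elim_inl, tz_apply, hz β _ _ hf, zero_mul]
      · simp only [blockFamily, Sum.elim_inr, tz_apply, blockVec]
        split_ifs with hc
        · rw [Pi.single_eq_of_ne, zero_mul]
          rintro h
          exact hf (h ▸ hc)
        · simp
    | zero => intros; rfl
    | add u v _ _ hu hv => intro f hf; simp [hu f hf, hv f hf]
    | smul b u _ hu => intro f hf; simp [hu f hf]
  refine sum_finrank_le_of_projections _ M (fun β => ?_) π ?_ ?_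
  · rw [span_le]
    rintro _ ⟨t | t, rfl⟩
    · simp only [blockFamily, Sum.elim_inl]
      by_cases h0 : z β t.1 = 0
      · rw [h0, tz_zero]
        exact M.zero_mem
      · exact hM2 β t.1 h0 (tz_mem_segTan _ _ _ (seg_update_mem_segTan _ _ _))
    · obtain ⟨v, hv⟩ := hM1 t.1
      exact hv (tz_seg_mem_segTan _ _ _ _)
  · intro β w hw
    funext f
    rw [hπ]
    split_ifs with h
    · rfl
    · exact (hsupp β w hw f h).symm
  · intro β β' hne w hw
    funext f
    rw [hπ]
    split_ifs with h
    · exact hsupp β' w hw f (h ▸ hne)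
    · rfl

end Slices

section SliceStep

open Module Submodule Function

variable {n a k : ℕ}

/-- Some `m` points of the Segre have linearly independent tangent spaces. -/
def HasMaxRank (n a m : ℕ) : Prop :=
  ∃ x : Fin m → Fin n → Fin (a + 1) → ℂ, m * (a * n + 1) ≤ finrank ℂ ↥(⨆ i, segTan (x i))

/-- Points `x` together with vectors `ζ` indexed by `I`, where `t : I` is attached to the point
`pt t`, such that the tangent spaces at the resulting points have the expected rank. -/
def HasSplitConfig (n a : ℕ) {k : ℕ} {I : Type} [Fintype I] (pt : I → Fin k) (j₀ : Fin (n + 1)) :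
    Prop :=
  ∃ (ζ : I → Fin (a + 1) → ℂ) (x : Fin k → Fin n → Fin (a + 1) → ℂ),
    ∀ M : Submodule ℂ ((Fin (n + 1) → Fin (a + 1)) → ℂ),
      (∀ t, segTan (j₀.insertNth (α := fun _ => Fin (a + 1) → ℂ) (ζ t) (x (pt t))) ≤ M) →
        (a + 1) * k + Fintype.card I * (a * n) ≤ finrank ℂ M

theorem seg_single (f : Fin n → Fin (a + 1)) :
    seg (fun j => Pi.single (f j) (1 : ℂ)) = Pi.single f 1 := by
  funext g
  rw [seg_apply]
  by_cases h : g = f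
  · subst h; simp
  · rw [Pi.single_eq_of_ne h]
    obtain ⟨j, hj⟩ := Function.ne_iff.1 h
    exact Finset.prod_eq_zero (Finset.mem_univ j) (Pi.single_eq_of_ne hj _)

theorem span_range_seg :
    span ℂ (Set.range (seg : _ → (Fin n → Fin (a + 1)) → ℂ)) = ⊤ := by
  rw [eq_top_iff, ← (Pi.basisFun ℂ (Fin n → Fin (a + 1))).span_eq]
  refine span_mono ?_
  rintro _ ⟨f, rfl⟩
  exact ⟨_, by rw [seg_single, Pi.basisFun_apply]⟩

theorem finrank_tensors : finrank ℂ ((Fin n → Fin (a + 1)) → ℂ) = (a + 1) ^ n := by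
  simp [Module.finrank_fintype_fun_eq_card]

/-- Adding general points to a configuration with independent tangent spaces. -/
theorem HasMaxRank.exists_extension {S : Finset (Fin k)} (hS : HasMaxRank n a S.card)
    (hle : k + S.card * (a * n) ≤ (a + 1) ^ n) :
    ∃ x : Fin k → Fin n → Fin (a + 1) → ℂ, k + S.card * (a * n) ≤
      finrank ℂ ↥((⨆ i ∈ S, segTan (x i)) ⊔ span ℂ (Set.range fun i => seg (x i))) := by
  classical
  obtain ⟨x, hx⟩ := hS
  have hSk : S.card ≤ k := by simpa using S.card_le_univ
  have hcard : Fintype.card {i // i ∉ S} = k - S.card := by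
    rw [Fintype.card_subtype_compl]; simp
  have hnum : S.card * (a * n + 1) + Fintype.card {i // i ∉ S} = k + S.card * (a * n) := by
    rw [hcard, mul_add, mul_one]; omega
  obtain ⟨y, hy, hy'⟩ := exists_finrank_sup_span_ge (J := {i // i ∉ S}) _ span_range_seg
    (⨆ i, segTan (x i)) _ hx (by rw [finrank_tensors, hnum]; exact hle)
  choose v hv using hy
  rw [hnum] at hy'
  let w : Fin k → Fin n → Fin (a + 1) → ℂ := fun i =>
    if h : i ∈ S then x (S.equivFin ⟨i, h⟩) else v ⟨i, h⟩
  refine ⟨w, hy'.trans (Submodule.finrank_mono (sup_le_sup ?_ (span_mono ?_)))⟩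
  · refine iSup_le fun i => ?_
    obtain ⟨⟨i', hi'⟩, rfl⟩ := S.equivFin.surjective i
    refine le_iSup₂_of_le i' hi' (le_of_eq ?_)
    simp only [w, dif_pos hi']
  · rintro _ ⟨i, rfl⟩
    exact ⟨i, by simp only [w, dif_neg i.2, hv]⟩

theorem tz_single_injective (j₀ : Fin (n + 1)) (c : Fin (a + 1)) :
    Injective (tz (n := n) j₀ (Pi.single c (1 : ℂ))) := by
  intro y y' h
  funext f
  have := congrFun h (j₀.insertNth (α := fun _ => Fin (a + 1)) c f)
  simpa [tz_apply] using this

/-- Distributing tangent spaces over the slices in one direction. -/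
theorem hasSplitConfig_of_slices {I : Type} [Fintype I] {pt : I → Fin k} (cls : I → Fin (a + 1))
    (hinj : Injective fun t => (pt t, cls t)) (hsurj : Surjective pt)
    (hP : ∀ c, HasMaxRank n a (Finset.univ.filter fun t => cls t = c).card)
    (hle : ∀ c, k + (Finset.univ.filter fun t => cls t = c).card * (a * n) ≤ (a + 1) ^ n)
    (j₀ : Fin (n + 1)) : HasSplitConfig n a pt j₀ := by
  classical
  let S (c : Fin (a + 1)) : Finset (Fin k) := (Finset.univ.filter fun t => cls t = c).image pt
  have hScard : ∀ c, (S c).card = (Finset.univ.filter fun t => cls t = c).card := by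
    intro c
    refine Finset.card_image_of_injOn fun t ht t' ht' h => hinj (Prod.ext h ?_)
    rw [Finset.mem_coe, Finset.mem_filter] at ht ht'
    exact ht.2.trans ht'.2.symm
  have hmem : ∀ t, pt t ∈ S (cls t) := fun t =>
    Finset.mem_image_of_mem _ (Finset.mem_filter.2 ⟨Finset.mem_univ _, rfl⟩)
  let z (c : Fin (a + 1)) (i : Fin k) : Fin (a + 1) → ℂ := if i ∈ S c then Pi.single c 1 else 0
  have hzt : ∀ t, z (cls t) (pt t) = Pi.single (cls t) 1 := fun t => if_pos (hmem t)
  obtain ⟨x, hx⟩ := exists_sum_le_finrank (n := n) j₀ id z (by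
    intro β i c hc
    simp only [z]
    split_ifs
    · exact Pi.single_eq_of_ne hc _
    · rfl) (fun c => k + (S c).card * (a * n)) (by
    intro c
    obtain ⟨x, hx⟩ := HasMaxRank.exists_extension (S := S c) (by rw [hScard]; exact hP c)
      (by rw [hScard]; exact hle c)
    refine ⟨x, hx.trans ?_⟩
    rw [(equivMapOfInjective _ (tz_single_injective j₀ c) _).finrank_eq]
    refine Submodule.finrank_mono ?_
    rw [map_le_iff_le_comap]
    refine sup_le (iSup₂_le fun i hi => ?_) (span_le.2 ?_)
    · rw [segTan_eq_span, span_le]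
      rintro _ ⟨t, rfl⟩
      refine subset_span ⟨Sum.inl (i, t), ?_⟩
      simp only [blockFamily, Sum.elim_inl, z, if_pos hi]
    · rintro _ ⟨i, rfl⟩
      refine subset_span ⟨Sum.inr (i, c), ?_⟩
      simp [blockFamily, blockVec])
  refine ⟨fun t => Pi.single (cls t) 1, x, fun M hM => ?_⟩
  have h1 := hx M (fun i => by
    obtain ⟨t, rfl⟩ := hsurj i
    exact ⟨_, hM t⟩) (by
    intro c i hne
    by_cases hi : i ∈ S c
    · obtain ⟨t, ht, rfl⟩ := Finset.mem_image.1 hi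
      have : cls t = c := (Finset.mem_filter.1 ht).2
      subst this
      rw [hzt]
      exact hM t
    · exact absurd (if_neg hi) hne)
  refine le_of_eq_of_le ?_ h1
  rw [Finset.sum_add_distrib, ← Finset.sum_mul, Finset.sum_congr rfl fun c _ => hScard c,
    ← Finset.card_eq_sum_card_fiberwise (fun t _ => Finset.mem_coe.2 (Finset.mem_univ (cls t)))]
  simp

/-- Split configurations with one vector per point have maximal rank. -/
theorem HasSplitConfig.hasMaxRank {m : ℕ} (j₀ : Fin (n + 1))
    (h : HasSplitConfig n a (id : Fin m → Fin m) j₀) : HasMaxRank (n + 1) a m := by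
  obtain ⟨ζ, x, h⟩ := h
  refine ⟨fun i => j₀.insertNth (ζ i) (x i), ?_⟩
  refine le_of_eq_of_le ?_ (h _ fun t => le_iSup (fun i => segTan
    (j₀.insertNth (α := fun _ => Fin (a + 1) → ℂ) (ζ i) (x i))) t)
  rw [Fintype.card_fin]
  ring

/-- Split configurations with one doubled point give maximal rank after moving one factor. -/
theorem HasSplitConfig.exists_update (i₀ : Fin k) (j₀ : Fin (n + 1))
    (h : HasSplitConfig n a (fun t : Option (Fin k) => t.getD i₀) j₀) :
    ∃ (p : Fin k → Fin (n + 1) → Fin (a + 1) → ℂ) (u : Fin (a + 1) → ℂ),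
      k * (a * (n + 1) + 1) + a * n ≤
        finrank ℂ ↥((⨆ i, segTan (p i)) ⊔ segTan (update (p i₀) j₀ u)) := by
  obtain ⟨ζ, x, h⟩ := h
  refine ⟨fun i => j₀.insertNth (ζ (some i)) (x i), ζ none, ?_⟩
  refine le_of_eq_of_le ?_ (h _ fun t => ?_)
  · rw [Fintype.card_option, Fintype.card_fin]
    ring
  · rcases t with _ | i
    · refine le_trans (le_of_eq ?_) le_sup_right
      rw [Fin.update_insertNth]
      rfl
    · exact le_trans (le_iSup (fun i => segTan
        (j₀.insertNth (α := fun _ => Fin (a + 1) → ℂ) (ζ (some i)) (x i))) i) le_sup_left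

/-- Balanced distribution of the elements of a finite type, separating two given elements. -/
theorem exists_balanced {I : Type} [Fintype I] {b : ℕ} (hb : 0 < b) (s t : I)
    (hst : s ≠ t → 2 ≤ b) : ∃ cls : I → Fin b, (s ≠ t → cls s ≠ cls t) ∧
      ∀ c, (Finset.univ.filter fun i => cls i = c).card ≤ (Fintype.card I - 1) / b + 1 := by
  classical
  have hpos : 0 < Fintype.card I := Fintype.card_pos_iff.2 ⟨s⟩
  obtain ⟨e, he⟩ : ∃ e : I ≃ Fin (Fintype.card I), s ≠ t → (e s : ℕ) = 0 ∧ (e t : ℕ) = 1 := by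
    let e₀ := Fintype.equivFin I
    by_cases h : s = t
    · exact ⟨e₀, fun h' => absurd h h'⟩
    · have h2 : 1 < Fintype.card I := Fintype.one_lt_card_iff.2 ⟨s, t, h⟩
      let e₁ := e₀.trans (Equiv.swap (e₀ s) ⟨0, hpos⟩)
      have h1 : e₁ s = ⟨0, hpos⟩ := by simp [e₁]
      refine ⟨e₁.trans (Equiv.swap (e₁ t) ⟨1, h2⟩), fun _ => ⟨?_, ?_⟩⟩
      · rw [Equiv.trans_apply, Equiv.swap_apply_of_ne_of_ne, h1]
        · exact e₁.injective.ne h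
        · rw [h1]; simp
      · simp
  refine ⟨fun i => ⟨(e i : ℕ) % b, Nat.mod_lt _ hb⟩, fun h => ?_, fun c => ?_⟩
  · obtain ⟨h0, h1⟩ := he h
    have := hst h
    intro h'
    have h' := Fin.ext_iff.1 h'
    simp only [h0, h1, Nat.zero_mod, Nat.mod_eq_of_lt (show 1 < b by omega)] at h'
    omega
  · rw [← Finset.card_range ((Fintype.card I - 1) / b + 1)]
    refine Finset.card_le_card_of_injOn (fun i => (e i : ℕ) / b) (fun i _ => ?_) ?_
    · rw [Finset.mem_coe, Finset.mem_range]
      exact Nat.lt_succ_of_le (Nat.div_le_div_right (by have := (e i).2; omega))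
    · intro i hi i' hi' h
      rw [Finset.mem_coe, Finset.mem_filter] at hi hi'
      have h1 := Fin.ext_iff.1 (hi.2.trans hi'.2.symm)
      simp only at h1 h
      apply e.injective
      apply Fin.ext
      rw [← Nat.div_add_mod (e i : ℕ) b, ← Nat.div_add_mod (e i' : ℕ) b, h, h1]

end SliceStep

section MatrixPairs

open Module Submodule Function

variable {a k : ℕ}

/-- Both copies of `v` in the square of its space. -/
def bothCopies {V : Type*} [AddCommGroup V] [Module ℂ V] (v : V) : Submodule ℂ (V × V) :=
  span ℂ (Set.range ![(v, 0), (0, v)])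

/-- The vectors both of whose copies lie in `T`. -/
def commonPart {V : Type*} [AddCommGroup V] [Module ℂ V] (T : Submodule ℂ (V × V)) :
    Submodule ℂ V :=
  T.comap (LinearMap.inl ℂ V V) ⊓ T.comap (LinearMap.inr ℂ V V)

section

variable {V : Type*} [AddCommGroup V] [Module ℂ V]

theorem bothCopies_le_iff {v : V} {T : Submodule ℂ (V × V)} :
    bothCopies v ≤ T ↔ v ∈ commonPart T := by
  rw [bothCopies, span_le, Set.range_subset_iff, Fin.forall_fin_two]
  rfl

theorem finrank_bothCopies_le (v : V) : finrank ℂ ↥(bothCopies v) ≤ 2 :=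
  (finrank_range_le_card (R := ℂ) ![((v, 0) : V × V), (0, v)]).trans (by simp)

theorem top_le_of_commonPart {T : Submodule ℂ (V × V)} (h : commonPart T = ⊤) : ⊤ ≤ T := by
  rintro ⟨u, v⟩ -
  have hu : u ∈ commonPart T := h ▸ mem_top
  have hv : v ∈ commonPart T := h ▸ mem_top
  simpa using T.add_mem hu.1 hv.2

theorem mem_commonPart_of_ne {T : Submodule ℂ (V × V)} {v : V} {b c : ℂ} (hbc : b ≠ c)
    (hb : (v, b • v) ∈ T) (hc : (v, c • v) ∈ T) : v ∈ commonPart T := by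
  have h1 : ((0 : V), v) ∈ T := by
    refine (T.smul_mem_iff (sub_ne_zero.2 hbc)).1 ?_
    convert T.sub_mem hb hc using 1
    simp [sub_smul]
  refine ⟨?_, h1⟩
  convert T.sub_mem hb (T.smul_mem b h1) using 1
  simp

theorem smul_mem_of_mem_commonPart {T : Submodule ℂ (V × V)} {v : V} (b : ℂ)
    (hv : v ∈ commonPart T) : (v, b • v) ∈ T := by
  convert T.add_mem hv.1 (T.smul_mem b hv.2) using 1
  simp

end

/-- The matrix unit. -/
def matUnit (r j : Fin (a + 1)) : (Fin 2 → Fin (a + 1)) → ℂ :=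
  seg ![Pi.single r 1, Pi.single j 1]

theorem matUnit_mem_left (r j : Fin (a + 1)) :
    matUnit r j ∈ segTan ![Pi.single r (1 : ℂ), Pi.single r 1] := by
  have := seg_update_mem_segTan ![Pi.single r (1 : ℂ), Pi.single r 1] 1 (Pi.single j 1)
  rwa [show update ![(Pi.single r 1 : Fin (a + 1) → ℂ), Pi.single r 1] 1 (Pi.single j 1) =
    ![Pi.single r 1, Pi.single j 1] by ext i; fin_cases i <;> simp] at this

theorem matUnit_mem_right (r j : Fin (a + 1)) :
    matUnit r j ∈ segTan ![Pi.single j (1 : ℂ), Pi.single j 1] := by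
  have := seg_update_mem_segTan ![Pi.single j (1 : ℂ), Pi.single j 1] 0 (Pi.single r 1)
  rwa [show update ![(Pi.single j 1 : Fin (a + 1) → ℂ), Pi.single j 1] 0 (Pi.single r 1) =
    ![Pi.single r 1, Pi.single j 1] by ext i; fin_cases i <;> simp] at this

theorem seg_add_add (r j r' j' : Fin (a + 1)) :
    seg ![Pi.single r (1 : ℂ) + Pi.single j 1, Pi.single r' 1 + Pi.single j' 1] =
      matUnit r r' + matUnit r j' + matUnit j r' + matUnit j j' := by
  funext f
  simp [seg_apply, matUnit, Fin.prod_univ_two]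
  ring

theorem eq_top_of_matUnit_mem {G : Submodule ℂ ((Fin 2 → Fin (a + 1)) → ℂ)}
    (h : ∀ r j, matUnit r j ∈ G) : G = ⊤ := by
  rw [eq_top_iff, ← (Pi.basisFun ℂ (Fin 2 → Fin (a + 1))).span_eq, span_le]
  rintro _ ⟨f, rfl⟩
  rw [SetLike.mem_coe, Pi.basisFun_apply, ← seg_single]
  have := h (f 0) (f 1)
  rwa [matUnit, show ![(Pi.single (f 0) 1 : Fin (a + 1) → ℂ), Pi.single (f 1) 1] =
    fun j => Pi.single (f j) 1 by ext i; fin_cases i <;> simp] at this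

/-- The tangent spaces at points `x i`, `i ∈ S`, embedded with slope `ζ i`, together with both
copies of all points. -/
def pairSpan (S : Finset (Fin k)) (ζ : Fin k → ℂ) (x : Fin k → Fin 2 → Fin (a + 1) → ℂ) :
    Submodule ℂ (((Fin 2 → Fin (a + 1)) → ℂ) × ((Fin 2 → Fin (a + 1)) → ℂ)) :=
  (⨆ i ∈ S, (segTan (x i)).map (LinearMap.prod LinearMap.id (ζ i • LinearMap.id))) ⊔
    ⨆ i, bothCopies (seg (x i))

theorem exists_pairSpan_of_top_le {S : Finset (Fin k)} {ζ : Fin k → ℂ}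
    (xS : Fin k → Fin 2 → Fin (a + 1) → ℂ) {F : Type} [Fintype F]
    (y : F → Fin 2 → Fin (a + 1) → ℂ)
    (R₀ : Submodule ℂ (((Fin 2 → Fin (a + 1)) → ℂ) × ((Fin 2 → Fin (a + 1)) → ℂ)))
    (htop : ∀ T, (∀ i ∈ S, ∀ v ∈ segTan (xS i), (v, ζ i • v) ∈ T) →
      (∀ i ∈ S, seg (xS i) ∈ commonPart T) → (∀ f, seg (y f) ∈ commonPart T) → R₀ ≤ T → ⊤ ≤ T)
    (hF : k - S.card ≤ Fintype.card F)
    (hR₀ : finrank ℂ R₀ + 2 * Fintype.card F + 2 * (S.card * (a + 1)) ≤ 2 * (a + 1) ^ 2) :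
    ∃ x : Fin k → Fin 2 → Fin (a + 1) → ℂ, 2 * (k + S.card * a) ≤ finrank ℂ ↥(pairSpan S ζ x) := by
  classical
  have hSk : S.card ≤ k := by simpa using S.card_le_univ
  have hcard : Fintype.card {i // i ∉ S} = k - S.card := by
    rw [Fintype.card_subtype_compl]; simp
  obtain ⟨φ⟩ : Nonempty ({i // i ∉ S} ↪ F) :=
    Embedding.nonempty_of_card_le (by rw [hcard]; exact hF)
  let x : Fin k → Fin 2 → Fin (a + 1) → ℂ := fun i => if h : i ∈ S then xS i else y (φ ⟨i, h⟩)
  have hxS : ∀ i ∈ S, x i = xS i := fun i hi => dif_pos hi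
  let R : Submodule ℂ (((Fin 2 → Fin (a + 1)) → ℂ) × ((Fin 2 → Fin (a + 1)) → ℂ)) :=
    ⨆ f : {f // f ∉ Set.range φ}, bothCopies (seg (y f))
  have hR : finrank ℂ R ≤ 2 * (Fintype.card F - (k - S.card)) := by
    refine (finrank_iSup_le_sum _).trans
      ((Finset.sum_le_card_nsmul _ _ 2 fun f _ => finrank_bothCopies_le _).trans (le_of_eq ?_))
    rw [Finset.card_univ, Fintype.card_subtype_compl, smul_eq_mul, mul_comm,
      ← hcard, ← Set.card_range_of_injective φ.injective]
  have hT := htop (pairSpan S ζ x ⊔ R ⊔ R₀) (fun i hi v hv => ?_) (fun i hi => ?_) (fun f => ?_)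
    le_sup_right
  · have h1 := Submodule.finrank_mono hT
    have h2 := Submodule.finrank_add_le_finrank_add_finrank (pairSpan S ζ x ⊔ R) R₀
    have h3 := Submodule.finrank_add_le_finrank_add_finrank (pairSpan S ζ x) R
    rw [finrank_top, finrank_prod, finrank_tensors] at h1
    refine ⟨x, ?_⟩
    have h4 : S.card * (a + 1) = S.card * a + S.card := by ring
    omega
  · refine mem_sup_left (mem_sup_left (mem_sup_left ?_))
    refine mem_iSup_of_mem i (mem_iSup_of_mem hi ⟨v, ?_, rfl⟩)
    rw [hxS i hi]
    exact hv
  · rw [← bothCopies_le_iff, ← hxS i hi]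
    exact (le_iSup (fun i => bothCopies (seg (x i))) i).trans
      (le_sup_right.trans (le_sup_left.trans le_sup_left))
  · rw [← bothCopies_le_iff]
    by_cases hf : f ∈ Set.range φ
    · obtain ⟨i, rfl⟩ := hf
      have : x i = y (φ i) := dif_neg i.2
      rw [← this]
      exact (le_iSup (fun i => bothCopies (seg (x i))) i.1).trans
        (le_sup_right.trans (le_sup_left.trans le_sup_left))
    · exact (le_iSup (fun f : {f // f ∉ Set.range φ} => bothCopies (seg (y f))) ⟨f, hf⟩).trans
        (le_sup_right.trans le_sup_left)

/-- Spanning when the number of tangent spaces is not one. -/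
theorem top_le_of_derangement {s : ℕ} (hs : s ≤ a + 1) {ζ : Fin s → ℂ} (hζ : Injective ζ)
    (τ : Equiv.Perm (Fin s)) (hτ : ∀ r, τ r ≠ r)
    {T : Submodule ℂ (((Fin 2 → Fin (a + 1)) → ℂ) × ((Fin 2 → Fin (a + 1)) → ℂ))}
    (h1 : ∀ r : Fin s, ∀ v ∈ segTan ![Pi.single (r.castLE hs) (1 : ℂ), Pi.single (r.castLE hs) 1],
      (v, ζ r • v) ∈ T)
    (h2 : ∀ r : Fin s, matUnit (r.castLE hs) (r.castLE hs) ∈ commonPart T)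
    (h3 : ∀ r j : Fin (a + 1), s ≤ r → s ≤ j → matUnit r j ∈ commonPart T)
    (h4 : ∀ (r : Fin s) (j : Fin (a + 1)), s ≤ j →
      seg ![Pi.single (r.castLE hs) (1 : ℂ) + Pi.single j 1,
        Pi.single ((τ r).castLE hs) 1 + Pi.single j 1] ∈ commonPart T) : ⊤ ≤ T := by
  have hSS : ∀ r j : Fin s, matUnit (r.castLE hs) (j.castLE hs) ∈ commonPart T := by
    intro r j
    by_cases h : r = j
    · exact h ▸ h2 r
    · exact mem_commonPart_of_ne (hζ.ne h) (h1 r _ (matUnit_mem_left _ _))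
        (h1 j _ (matUnit_mem_right _ _))
  have hboth : ∀ (r : Fin s) (j : Fin (a + 1)), s ≤ j → matUnit (r.castLE hs) j ∈ commonPart T ∧
      matUnit j ((τ r).castLE hs) ∈ commonPart T := by
    intro r j hj
    have hsum := h4 r j hj
    rw [seg_add_add, Submodule.add_mem_iff_left _ (h3 j j hj hj), add_assoc,
      Submodule.add_mem_iff_right _ (hSS r (τ r))] at hsum
    have hu : matUnit (r.castLE hs) j ∈ commonPart T := by
      refine mem_commonPart_of_ne (hζ.ne (hτ r).symm) (h1 r _ (matUnit_mem_left _ _)) ?_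
      convert T.sub_mem (smul_mem_of_mem_commonPart (ζ (τ r)) hsum)
        (h1 (τ r) _ (matUnit_mem_right j _)) using 1
      simp
    exact ⟨hu, (Submodule.add_mem_iff_right _ hu).1 hsum⟩
  refine top_le_of_commonPart (eq_top_of_matUnit_mem fun r j => ?_)
  by_cases hr : (r : ℕ) < s
  · by_cases hj : (j : ℕ) < s
    · exact hSS ⟨r, hr⟩ ⟨j, hj⟩
    · exact (hboth ⟨r, hr⟩ j (not_lt.1 hj)).1
  · by_cases hj : (j : ℕ) < s
    · have := (hboth (τ.symm ⟨j, hj⟩) r (not_lt.1 hr)).2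
      rw [Equiv.apply_symm_apply] at this
      exact this
    · exact h3 r j (not_lt.1 hr) (not_lt.1 hj)

/-- Spanning with one tangent space. -/
theorem top_le_of_single {ζ : ℂ}
    {T : Submodule ℂ (((Fin 2 → Fin (a + 1)) → ℂ) × ((Fin 2 → Fin (a + 1)) → ℂ))}
    (h1 : ∀ v ∈ segTan ![Pi.single (0 : Fin (a + 1)) (1 : ℂ), Pi.single 0 1], (v, ζ • v) ∈ T)
    (h2 : matUnit 0 0 ∈ commonPart T)
    (h3 : ∀ r j : Fin a, matUnit r.succ j.succ ∈ commonPart T)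
    (h4 : ∀ j : Fin a, ((0, matUnit 0 j.succ) : _ × _) ∈ T)
    (h5 : ∀ j : Fin a, ((0, matUnit j.succ 0) : _ × _) ∈ T) : ⊤ ≤ T := by
  have key : ∀ v, (v, ζ • v) ∈ T → (0, v) ∈ T → v ∈ commonPart T := by
    intro v hv hv'
    refine ⟨?_, hv'⟩
    convert T.sub_mem hv (T.smul_mem ζ hv') using 1
    simp
  refine top_le_of_commonPart (eq_top_of_matUnit_mem fun r j => ?_)
  induction r using Fin.cases with
  | zero =>
    induction j using Fin.cases with
    | zero => exact h2
    | succ j => exact key _ (h1 _ (matUnit_mem_left _ _)) (h4 j)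
  | succ r =>
    induction j using Fin.cases with
    | zero => exact key _ (h1 _ (matUnit_mem_right _ _)) (h5 r)
    | succ j => exact h3 r j

theorem exists_fixedPointFree (s : ℕ) (hs : s ≠ 1) : ∃ τ : Equiv.Perm (Fin s), ∀ r, τ r ≠ r := by
  match s, hs with
  | 0, _ => exact ⟨1, fun r => r.elim0⟩
  | m + 2, _ =>
    refine ⟨finRotate _, fun r h => ?_⟩
    rw [finRotate_apply] at h
    simp at h

/-- Maximal rank in a block of two slices. -/
theorem exists_le_finrank_pairSpan {S : Finset (Fin k)} {ζ : Fin k → ℂ} (hζ : Injective ζ)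
    (hs : S.card ≤ a + 1) (hk : k + S.card * a ≤ (a + 1) ^ 2) (h1 : S.card = 1 → k - 1 ≤ a ^ 2) :
    ∃ x : Fin k → Fin 2 → Fin (a + 1) → ℂ,
      2 * (k + S.card * a) ≤ finrank ℂ ↥(pairSpan S ζ x) := by
  classical
  by_cases hone : S.card = 1
  · obtain ⟨i₀, rfl⟩ := Finset.card_eq_one.1 hone
    let g : Fin a ⊕ Fin a → ((Fin 2 → Fin (a + 1)) → ℂ) × ((Fin 2 → Fin (a + 1)) → ℂ) :=
      Sum.elim (fun j => (0, matUnit 0 j.succ)) fun j => (0, matUnit j.succ 0)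
    refine exists_pairSpan_of_top_le (fun _ => ![Pi.single 0 1, Pi.single 0 1])
      (F := Fin a × Fin a) (fun f => ![Pi.single f.1.succ 1, Pi.single f.2.succ 1])
      (span ℂ (Set.range g)) (fun T hT1 hT2 hT3 hT4 => ?_) ?_ ?_
    · have hi : i₀ ∈ ({i₀} : Finset (Fin k)) := Finset.mem_singleton_self _
      exact top_le_of_single (hT1 i₀ hi) (hT2 i₀ hi) (fun r j => hT3 (r, j))
        (fun j => hT4 (subset_span ⟨Sum.inl j, rfl⟩)) fun j => hT4 (subset_span ⟨Sum.inr j, rfl⟩)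
    · rw [hone, Fintype.card_prod, Fintype.card_fin, ← pow_two]
      exact h1 hone
    · have h2 := finrank_range_le_card (R := ℂ) g
      rw [Fintype.card_sum, Fintype.card_fin] at h2
      change finrank ℂ ↥(span ℂ (Set.range g)) ≤ _ at h2
      rw [hone, Fintype.card_prod, Fintype.card_fin]
      nlinarith
  · obtain ⟨τ, hτ⟩ := exists_fixedPointFree S.card hone
    let e := S.equivFin
    let xS : Fin k → Fin 2 → Fin (a + 1) → ℂ := fun i => if h : i ∈ S then
      ![Pi.single ((e ⟨i, h⟩).castLE hs) 1, Pi.single ((e ⟨i, h⟩).castLE hs) 1] else 0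
    have hxS : ∀ r, xS (e.symm r) = ![Pi.single (r.castLE hs) 1, Pi.single (r.castLE hs) 1] := by
      intro r
      simp only [xS, dif_pos (e.symm r).2, Subtype.coe_eta, Equiv.apply_symm_apply]
    let y : Fin (a + 1) × {j : Fin (a + 1) // S.card ≤ j} → Fin 2 → Fin (a + 1) → ℂ := fun f =>
      if h : (f.1 : ℕ) < S.card then
        ![Pi.single f.1 1 + Pi.single f.2.1 1,
          Pi.single ((τ ⟨f.1, h⟩).castLE hs) 1 + Pi.single f.2.1 1]
      else ![Pi.single f.1 1, Pi.single f.2.1 1]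
    have hcard : Fintype.card (Fin (a + 1) × {j : Fin (a + 1) // S.card ≤ j}) =
        (a + 1) * (a + 1 - S.card) := by
      rw [Fintype.card_prod, Fintype.card_fin]
      congr 1
      have h2 := Fintype.card_subtype_compl fun j : Fin (a + 1) => (j : ℕ) < S.card
      simp only [not_lt] at h2
      rw [h2, Fintype.card_fin]
      congr 1
      exact (Fintype.card_congr (Fin.castLEquiv hs).symm).trans (Fintype.card_fin _)
    have hprod : (a + 1) * (a + 1 - S.card) + S.card * (a + 1) = (a + 1) ^ 2 := by
      rw [mul_comm S.card, ← mul_add, Nat.sub_add_cancel hs, pow_two]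
    refine exists_pairSpan_of_top_le xS y ⊥ (fun T hT1 hT2 hT3 _ => ?_) ?_ ?_
    · refine top_le_of_derangement hs (ζ := fun r => ζ (e.symm r))
        (hζ.comp (Subtype.val_injective.comp e.symm.injective)) τ hτ ?_ ?_ ?_ ?_
      · intro r v hv
        exact hT1 _ (e.symm r).2 v (by rw [hxS]; exact hv)
      · intro r
        have := hT2 _ (e.symm r).2
        rwa [hxS] at this
      · intro r j hr hj
        have := hT3 (r, ⟨j, hj⟩)
        simp only [y, dif_neg (not_lt.2 hr)] at this
        exact this
      · intro r j hj
        have := hT3 (r.castLE hs, ⟨j, hj⟩)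
        simp only [y, Fin.val_castLE, r.2, dif_pos] at this
        exact this
    · rw [hcard]
      have : S.card * (a + 1) = S.card * a + S.card := by ring
      omega
    · rw [hcard, finrank_bot]
      omega

end MatrixPairs

section BlockStep

open Module Submodule Function

variable {a k : ℕ}

/-- Two slices side by side. -/
def twoSlices {n : ℕ} (j₀ : Fin (n + 1)) (c₀ c₁ : Fin (a + 1)) :
    ((Fin n → Fin (a + 1)) → ℂ) × ((Fin n → Fin (a + 1)) → ℂ) →ₗ[ℂ]
      ((Fin (n + 1) → Fin (a + 1)) → ℂ) :=
  LinearMap.coprod (tz j₀ (Pi.single c₀ 1)) (tz j₀ (Pi.single c₁ 1))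

theorem twoSlices_injective {n : ℕ} (j₀ : Fin (n + 1)) {c₀ c₁ : Fin (a + 1)} (h : c₀ ≠ c₁) :
    Injective (twoSlices (n := n) j₀ c₀ c₁) := by
  rintro ⟨y, y'⟩ ⟨u, u'⟩ he
  refine Prod.ext (funext fun f => ?_) (funext fun f => ?_)
  · have := congrFun he (j₀.insertNth (α := fun _ => Fin (a + 1)) c₀ f)
    simpa [twoSlices, tz_apply, Pi.single_apply, h] using this
  · have := congrFun he (j₀.insertNth (α := fun _ => Fin (a + 1)) c₁ f)
    simpa [twoSlices, tz_apply, Pi.single_apply, h.symm] using this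

theorem map_pairSpan_le (j₀ : Fin 3) (c₀ c₁ : Fin (a + 1)) {S : Finset (Fin k)}
    {ζ : Fin k → ℂ} {z : Fin k → Fin (a + 1) → ℂ}
    (hz : ∀ i ∈ S, z i = Pi.single c₀ 1 + ζ i • Pi.single c₁ 1)
    {E : Fin (a + 1) → Fin (a + 1) → ℂ} (h₀ : E c₀ = Pi.single c₀ 1) (h₁ : E c₁ = Pi.single c₁ 1)
    (x : Fin k → Fin 2 → Fin (a + 1) → ℂ) :
    (pairSpan S ζ x).map (twoSlices j₀ c₀ c₁) ≤ span ℂ (Set.range (blockFamily j₀ z E x)) := by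
  rw [map_le_iff_le_comap]
  refine sup_le (iSup₂_le fun i hi => ?_) (iSup_le fun i => ?_)
  · rw [map_le_iff_le_comap, segTan_eq_span, span_le]
    rintro _ ⟨t, rfl⟩
    refine subset_span ⟨Sum.inl (i, t), ?_⟩
    simp only [blockFamily, Sum.elim_inl, hz i hi, tz_add, tz_smul]
    simp [twoSlices]
  · rw [bothCopies, span_le, Set.range_subset_iff, Fin.forall_fin_two]
    refine ⟨subset_span ⟨Sum.inr (i, c₀), ?_⟩, subset_span ⟨Sum.inr (i, c₁), ?_⟩⟩
    · simp [blockFamily, h₀, twoSlices]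
    · simp [blockFamily, h₁, twoSlices]

/-- Distributing tangent spaces over blocks of two slices. -/
theorem hasSplitConfig_of_blocks {I : Type} [Fintype I] {pt : I → Fin k}
    (cls : I → Fin ((a + 1) / 2))
    (hinj : Injective fun t => (pt t, cls t)) (hsurj : Surjective pt)
    (hs : ∀ c, (Finset.univ.filter fun t => cls t = c).card ≤ a + 1)
    (hle : ∀ c, k + (Finset.univ.filter fun t => cls t = c).card * a ≤ (a + 1) ^ 2)
    (hone : k - 1 ≤ a ^ 2) (hk : k ≤ (a + 1) ^ 2) (j₀ : Fin 3) : HasSplitConfig 2 a pt j₀ := by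
  classical
  let S (c : Fin ((a + 1) / 2)) : Finset (Fin k) :=
    (Finset.univ.filter fun t => cls t = c).image pt
  have hScard : ∀ c, (S c).card = (Finset.univ.filter fun t => cls t = c).card := by
    intro c
    refine Finset.card_image_of_injOn fun t ht t' ht' h => hinj (Prod.ext h ?_)
    rw [Finset.mem_coe, Finset.mem_filter] at ht ht'
    exact ht.2.trans ht'.2.symm
  have hmem : ∀ t, pt t ∈ S (cls t) := fun t =>
    Finset.mem_image_of_mem _ (Finset.mem_filter.2 ⟨Finset.mem_univ _, rfl⟩)
  let c₀ (β : Fin ((a + 1) / 2)) : Fin (a + 1) := ⟨2 * β, by have := β.2; omega⟩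
  let c₁ (β : Fin ((a + 1) / 2)) : Fin (a + 1) := ⟨2 * β + 1, by have := β.2; omega⟩
  let blk (c : Fin (a + 1)) : Option (Fin ((a + 1) / 2)) :=
    if h : (c : ℕ) / 2 < (a + 1) / 2 then some ⟨c / 2, h⟩ else none
  have hblk₀ : ∀ β, blk (c₀ β) = some β := by
    intro β
    have h : (c₀ β : ℕ) / 2 = β := by simp [c₀]
    simp only [blk, h, β.2, dif_pos]
  have hblk₁ : ∀ β, blk (c₁ β) = some β := by
    intro β
    have h : (c₁ β : ℕ) / 2 = β := by simp only [c₁]; omega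
    simp only [blk, h, β.2, dif_pos]
  let vec (β : Fin ((a + 1) / 2)) (i : Fin k) : Fin (a + 1) → ℂ :=
    Pi.single (c₀ β) 1 + ((i : ℕ) : ℂ) • Pi.single (c₁ β) 1
  let z (β : Option (Fin ((a + 1) / 2))) (i : Fin k) : Fin (a + 1) → ℂ :=
    β.elim 0 fun β => if i ∈ S β then vec β i else 0
  have hzS : ∀ β, ∀ i ∈ S β, z (some β) i = vec β i := fun β i hi => if_pos hi
  obtain ⟨x, hx⟩ := exists_sum_le_finrank (n := 2) j₀ blk z (by
    rintro (_ | β) i c hc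
    · rfl
    · by_cases hi : i ∈ S β
      · rw [hzS β i hi]
        have h0 : c ≠ c₀ β := fun h => hc (h ▸ hblk₀ β)
        have h1 : c ≠ c₁ β := fun h => hc (h ▸ hblk₁ β)
        simp [vec, h0, h1]
      · simp [z, hi])
    (fun β => β.elim (k * ((a + 1) % 2)) fun β => 2 * (k + (S β).card * a)) (by
    rintro (_ | β)
    · rcases Nat.mod_two_eq_zero_or_one (a + 1) with h | h
      · exact ⟨0, by simp [h]⟩
      · obtain ⟨y, hy, hy'⟩ := exists_finrank_sup_span_ge (J := Fin k) _
          (span_range_seg (n := 2) (a := a)) ⊥ 0 (Nat.zero_le _) (by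
            rw [finrank_tensors, Fintype.card_fin, zero_add]; exact hk)
        choose v hv using hy
        refine ⟨v, ?_⟩
        rw [zero_add, Fintype.card_fin, bot_sup_eq] at hy'
        simp only [Option.elim_none, h, mul_one]
        refine hy'.trans ?_
        rw [(equivMapOfInjective _ (tz_single_injective j₀ (Fin.last a)) _).finrank_eq]
        refine Submodule.finrank_mono ?_
        rw [map_le_iff_le_comap, span_le]
        rintro _ ⟨i, rfl⟩
        refine subset_span ⟨Sum.inr (i, Fin.last a), ?_⟩
        have hlast : blk (Fin.last a) = none := by
          simp only [blk, Fin.val_last]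
          rw [dif_neg]
          omega
        simp [blockFamily, blockVec, hlast, hv]
    · obtain ⟨x, hx⟩ := exists_le_finrank_pairSpan (S := S β) (a := a)
        (ζ := fun i : Fin k => ((i : ℕ) : ℂ)) (fun i j h => Fin.ext (Nat.cast_injective h))
        (by rw [hScard]; exact hs β) (by rw [hScard]; exact hle β) fun _ => hone
      refine ⟨x, hx.trans ?_⟩
      have hne : c₀ β ≠ c₁ β := fun h => by
        have := Fin.ext_iff.1 h
        simp [c₀, c₁] at this
      rw [(equivMapOfInjective _ (twoSlices_injective j₀ hne) _).finrank_eq]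
      exact Submodule.finrank_mono (map_pairSpan_le j₀ _ _ (hzS β) (if_pos (hblk₀ β))
        (if_pos (hblk₁ β)) x))
  refine ⟨fun t => vec (cls t) (pt t), x, fun M hM => ?_⟩
  have h1 := hx M (fun i => by
    obtain ⟨t, rfl⟩ := hsurj i
    exact ⟨_, hM t⟩) (by
    rintro (_ | β) i hne
    · exact absurd rfl hne
    by_cases hi : i ∈ S β
    · obtain ⟨t, ht, rfl⟩ := Finset.mem_image.1 hi
      have : cls t = β := (Finset.mem_filter.1 ht).2
      subst this
      rw [hzS _ _ hi]
      exact hM t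
    · exact absurd (if_neg hi) hne)
  refine le_of_eq_of_le ?_ h1
  rw [Fintype.sum_option]
  simp only [Option.elim_none, Option.elim_some]
  rw [← Finset.mul_sum, Finset.sum_add_distrib, ← Finset.sum_mul,
    Finset.sum_congr rfl fun c _ => hScard c,
    ← Finset.card_eq_sum_card_fiberwise (fun t _ => Finset.mem_coe.2 (Finset.mem_univ (cls t)))]
  simp only [Finset.sum_const, Finset.card_univ, Fintype.card_fin, smul_eq_mul]
  have h2 := Nat.div_add_mod (a + 1) 2
  generalize (a + 1) / 2 = b at h2
  generalize (a + 1) % 2 = m at h2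
  rw [← h2]
  ring

end BlockStep

section Numerics

open Module Submodule Function

variable {n a k : ℕ}

/-- The number `(a + 1)^n - (3a + 1)(a + 1)^(n - 2)` bounding the dimension of the subspaces. -/
def segBound (a n : ℕ) : ℕ := (a + 1) ^ (n - 2) * (a * (a - 1))

theorem segBound_add (a : ℕ) (hn : 2 ≤ n) :
    segBound a n + (3 * a + 1) * (a + 1) ^ (n - 2) = (a + 1) ^ n := by
  obtain ⟨m, rfl⟩ := Nat.exists_eq_add_of_le' hn
  rw [segBound, Nat.add_sub_cancel]
  rcases a with _ | c
  · simp
  · simp only [Nat.add_sub_cancel]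
    ring

theorem segBound_eq (a : ℕ) (hn : 2 ≤ n) :
    (a + 1) ^ n - (3 * a + 1) * (a + 1) ^ (n - 2) = segBound a n := by
  have := segBound_add a hn
  omega

theorem segBound_succ (a : ℕ) (hn : 2 ≤ n) : segBound a (n + 1) = (a + 1) * segBound a n := by
  rw [segBound, segBound, Nat.sub_add_comm hn]
  ring

theorem segBound_add_le (a : ℕ) (hn : 2 ≤ n) : segBound a n + (a * n + 1) ≤ (a + 1) ^ n := by
  rw [← segBound_add a hn]
  obtain ⟨m, rfl⟩ := Nat.exists_eq_add_of_le' hn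
  rw [Nat.add_sub_cancel]
  have hpow : 1 + m * a ≤ (a + 1) ^ m := by
    have := one_add_mul_le_pow (R := ℤ) (a := a) (by omega) m
    rw [add_comm a 1]
    exact_mod_cast this
  nlinarith [Nat.mul_le_mul_left (3 * a + 1) hpow, Nat.zero_le (m * a * a), Nat.zero_le (m * a)]

/-- The projection `pt` is injective except that it may identify `s` with `t`. -/
def IdentifiesOnly {I J : Type*} (pt : I → J) (s t : I) : Prop :=
  ∀ x y, pt x = pt y → x = y ∨ (x = s ∧ y = t) ∨ (x = t ∧ y = s)

theorem IdentifiesOnly.injective {I J L : Type*} {pt : I → J} {s t : I}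
    (h : IdentifiesOnly pt s t) {cls : I → L} (hcls : s ≠ t → cls s ≠ cls t) :
    Injective fun x => (pt x, cls x) := by
  intro x y hxy
  obtain ⟨h₁, h₂⟩ := Prod.mk.inj hxy
  rcases h x y h₁ with h' | ⟨rfl, rfl⟩ | ⟨rfl, rfl⟩
  · exact h'
  · by_contra hne
    exact hcls hne h₂
  · by_contra hne
    exact hcls (Ne.symm hne) h₂.symm

theorem identifiesOnly_id {I : Type*} (s : I) : IdentifiesOnly (id : I → I) s s :=
  fun _ _ h => Or.inl h

theorem identifiesOnly_getD {I : Type*} (i₀ : I) :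
    IdentifiesOnly (fun t : Option I => t.getD i₀) none (some i₀) := by
  rintro (_ | x) (_ | y) h <;> simp_all [eq_comm]

variable {I : Type} [Fintype I] {pt : I → Fin k}

theorem le_card_sub_one_add_one (hsurj : Surjective pt) : k ≤ Fintype.card I - 1 + 1 := by
  have := Fintype.card_le_of_surjective pt hsurj
  rw [Fintype.card_fin] at this
  omega

theorem hasSplitConfig_two (ha : 1 ≤ a) {s t : I} (hst : IdentifiesOnly pt s t)
    (hsurj : Surjective pt)
    (hcard : (Fintype.card I - 1) * (a * 3 + 1) ≤ segBound a 3) (j₀ : Fin 3) :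
    HasSplitConfig 2 a pt j₀ := by
  obtain ⟨c, rfl⟩ := Nat.exists_eq_add_of_le' ha
  have hk := le_card_sub_one_add_one hsurj
  simp only [segBound, Nat.add_sub_cancel] at hcard
  have hb : s ≠ t → 2 ≤ (c + 1 + 1) / 2 := by
    intro hne
    have h2 : 1 ≤ Fintype.card I - 1 := by
      have := Fintype.one_lt_card_iff.2 ⟨s, t, hne⟩
      omega
    have h3 := (Nat.mul_le_mul_right ((c + 1) * 3 + 1) h2).trans hcard
    have : 2 ≤ c := by
      by_contra hlt
      have : c < 2 := by omega
      interval_cases c <;> simp at h3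
    omega
  obtain ⟨cls, hne, hbal⟩ := exists_balanced (by omega : 0 < (c + 1 + 1) / 2) s t hb
  generalize Fintype.card I - 1 = K at *
  have hK3 : 3 * K ≤ (c + 2) * c := by
    refine le_of_mul_le_mul_left (a := c + 1) ?_ (Nat.succ_pos _)
    ring_nf at hcard ⊢
    nlinarith
  have hdiv : K / ((c + 1 + 1) / 2) * (c + 1) ≤ 2 * K := by
    have h₁ := Nat.div_mul_le_self K ((c + 1 + 1) / 2)
    have h₂ : c + 1 ≤ 2 * ((c + 1 + 1) / 2) := by omega
    calc _ ≤ K / ((c + 1 + 1) / 2) * (2 * ((c + 1 + 1) / 2)) := Nat.mul_le_mul_left _ h₂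
      _ = 2 * (K / ((c + 1 + 1) / 2) * ((c + 1 + 1) / 2)) := by ring
      _ ≤ _ := Nat.mul_le_mul_left _ h₁
  generalize K / ((c + 1 + 1) / 2) = D at *
  have hD : D ≤ c + 1 := by
    refine le_of_mul_le_mul_right (a := c + 1) ?_ (Nat.succ_pos _)
    nlinarith
  refine hasSplitConfig_of_blocks cls (hst.injective hne) hsurj (fun x => (hbal x).trans (by omega))
    (fun x => ?_) ?_ ?_ j₀
  · have := Nat.mul_le_mul_right (c + 1) (hbal x)
    nlinarith
  · have : K ≤ (c + 1) ^ 2 := by nlinarith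
    omega
  · nlinarith

theorem hasSplitConfig_succ (ha : 1 ≤ a) (hn : 2 ≤ n)
    (hP : ∀ m, (m - 1) * (a * n + 1) ≤ segBound a n → HasMaxRank n a m)
    {s t : I} (hst : IdentifiesOnly pt s t) (hsurj : Surjective pt)
    (hcard : (Fintype.card I - 1) * (a * (n + 1) + 1) ≤ segBound a (n + 1)) (j₀ : Fin (n + 1)) :
    HasSplitConfig n a pt j₀ := by
  have hk := le_card_sub_one_add_one hsurj
  obtain ⟨cls, hne, hbal⟩ := exists_balanced (by omega : 0 < a + 1) s t (fun _ => by omega)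
  rw [segBound_succ a hn] at hcard
  generalize Fintype.card I - 1 = K at *
  have hdiv := Nat.div_mul_le_self K (a + 1)
  generalize K / (a + 1) = D at *
  have hD : K + D * (a * n) ≤ segBound a n := by
    refine le_of_mul_le_mul_left (a := a + 1) ?_ (Nat.succ_pos _)
    have := Nat.mul_le_mul_right (a * n) hdiv
    nlinarith
  have hle := segBound_add_le a hn
  refine hasSplitConfig_of_slices cls (hst.injective hne) hsurj (fun c => hP _ ?_) (fun c => ?_) j₀
  · have h₁ : (Finset.univ.filter fun t => cls t = c).card - 1 ≤ D := by
      have := hbal c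
      omega
    have h₂ := Nat.mul_le_mul_right (a * n + 1) h₁
    have h₃ : D ≤ K := by nlinarith
    nlinarith
  · have := Nat.mul_le_mul_right (a * n) (hbal c)
    nlinarith

theorem hasMaxRank_of_le (ha : 1 ≤ a) (hn : 3 ≤ n) :
    ∀ m, (m - 1) * (a * n + 1) ≤ segBound a n → HasMaxRank n a m := by
  induction n, hn using Nat.le_induction with
  | base =>
    intro m hm
    rcases m with _ | m
    · exact ⟨Fin.elim0, by simp⟩
    · exact (hasSplitConfig_two ha (identifiesOnly_id (0 : Fin (m + 1))) surjective_id
        (by simpa using hm) 0).hasMaxRank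
  | succ n hn ih =>
    intro m hm
    rcases m with _ | m
    · exact ⟨Fin.elim0, by simp⟩
    · exact (hasSplitConfig_succ ha (by omega) ih (identifiesOnly_id (0 : Fin (m + 1)))
        surjective_id (by simpa using hm) 0).hasMaxRank

theorem exists_finrank_update_ge (ha : 1 ≤ a) (hn : 3 ≤ n) (hk : k * (a * n + 1) ≤ segBound a n)
    (i₀ : Fin k) (j₀ : Fin n) :
    ∃ (p : Fin k → Fin n → Fin (a + 1) → ℂ) (u : Fin (a + 1) → ℂ),
      k * (a * n + 1) + a * (n - 1) ≤
        finrank ℂ ↥((⨆ i, segTan (p i)) ⊔ segTan (update (p i₀) j₀ u)) := by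
  obtain ⟨N, rfl⟩ := Nat.exists_eq_add_of_le' (by omega : 1 ≤ n)
  have hsurj : Surjective fun t : Option (Fin k) => t.getD i₀ := fun i => ⟨some i, rfl⟩
  refine HasSplitConfig.exists_update i₀ j₀ ?_
  obtain rfl | hN := (by omega : 2 ≤ N).eq_or_lt
  · exact hasSplitConfig_two ha (identifiesOnly_getD i₀) hsurj (by simpa using hk) j₀
  · exact hasSplitConfig_succ ha (by omega) (hasMaxRank_of_le ha hN) (identifiesOnly_getD i₀) hsurj
      (by simpa using hk) j₀

theorem exists_finrank_tanSpan_update_ge (ha : 1 ≤ a) (hn : 3 ≤ n) {e : ℕ}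
    (hk : k * (a * n + 1) + e ≤ segBound a n) (i₀ : Fin k) (j₀ : Fin n) :
    ∃ (p : Fin k → Fin n → Fin (a + 1) → ℂ) (c : Fin e → (Fin n → Fin (a + 1)) → ℂ)
      (u : Fin (a + 1) → ℂ), k * (a * n + 1) + e + a * (n - 1) ≤
        finrank ℂ ↥(tanSpan p c ⊔ segTan (update (p i₀) j₀ u)) := by
  obtain ⟨p, u, hpu⟩ := exists_finrank_update_ge ha hn (by omega) i₀ j₀
  have hle := segBound_add_le a (by omega : 2 ≤ n)
  have hmul : a * (n - 1) ≤ a * n := Nat.mul_le_mul_left a (Nat.sub_le n 1)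
  obtain ⟨c, -, hc⟩ := exists_finrank_sup_span_ge (J := Fin e) Set.univ
    (span_univ (R := ℂ) (M := (Fin n → Fin (a + 1)) → ℂ)) _ _ hpu
    (by rw [finrank_tensors, Fintype.card_fin]; omega)
  refine ⟨p, c, u, ?_⟩
  rw [tanSpan, sup_right_comm]
  rw [Fintype.card_fin] at hc
  omega

end Numerics

/-- `n ≥ 3` copies of `ℙ^a`:
(i) tangential generality for subspaces of dimension
`r + 1 ≤ (a+1)^n - (3a+1)(a+1)^{n-2}` and `k ≤ (r+1)/(an+1)`;
(ii) consequently, `k`-identifiability for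
`k ≤ ((a+1)^n - (3a+1)(a+1)^{n-2})/(an+1)`. -/
theorem stmt_13 (a n : ℕ) (ha : 1 ≤ a) (hn : 3 ≤ n) :
    (∀ r k : ℕ, 0 < r → 0 < k →
      r + 1 ≤ (a + 1) ^ n - (3 * a + 1) * (a + 1) ^ (n - 2) →
      (k : ℚ) ≤ ((r : ℚ) + 1) / ((a : ℚ) * n + 1) →
      TangentGeneral n (fun _ => a) k (r + 1)) ∧
    (∀ k : ℕ, 0 < k →
      (k : ℚ) ≤ (((a + 1) ^ n - (3 * a + 1) * (a + 1) ^ (n - 2) : ℕ) : ℚ) /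
        ((a : ℚ) * n + 1) →
      Identifiable n (fun _ => a) k) := by
  have hpos : (0 : ℚ) < (a : ℚ) * n + 1 := by positivity
  rw [segBound_eq a (by omega)]
  refine ⟨fun r k _ hk hr hkr => ?_, fun k hk hkr => ?_⟩
  · rw [le_div_iff₀ hpos] at hkr
    have hle : k * (a * n + 1) ≤ r + 1 := by exact_mod_cast hkr
    have hdim : 1 + ∑ _ : Fin n, a = a * n + 1 := by simp; ring
    refine tangentGeneral_of_witness hk (by omega) ha (e := r + 1 - k * (a * n + 1))
      (by rw [hdim]) (by omega) fun i j₀ => ?_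
    exact exists_finrank_tanSpan_update_ge ha hn (by omega) i j₀
  · rw [le_div_iff₀ hpos] at hkr
    have hle : k * (a * n + 1) ≤ segBound a n := by exact_mod_cast hkr
    exact identifiable_of_witness hk (by omega) ha fun i j₀ =>
      exists_finrank_tanSpan_update_ge ha hn (by omega) i j₀
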